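/- For every C > 0 and ε > 0 there exists D₀ = D₀(C, ε) such that the following holds for every integer D ≥ D₀: if G₁, …, G_m are nearly disjoint graphs, each of maximum degree at most D, such that each vertex v ∈ ⋃_{i=1}^m V(G_i) is contained in at most C of the graphs G₁, …, G_m, then the list chromatic number of ⋃_{i=1}^m G_i is at most (1 + ε)D. -/

import Mathlib

open Finset

/-! ### Expectations on finite product spaces -/

namespace ProductSpace

variable {ι α : Type*}

/-- `μ i` is a probability vector on `α` for every coordinate `i`. -/
structure IsWeight [Fintype α] (μ : ι → α → ℝ) : Prop where
  nonneg : ∀ i x, 0 ≤ μ i x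
  sum_eq_one : ∀ i, ∑ x, μ i x = 1

/-- The expectation of `f` when the coordinates are independent with laws `μ i`. -/
def expect [Fintype ι] [Fintype α] [DecidableEq ι] (μ : ι → α → ℝ) (f : (ι → α) → ℝ) : ℝ :=
  ∑ ω, (∏ i, μ i (ω i)) * f ω

/-- Average `f` over the coordinate `i` alone. -/
def avg [Fintype α] [DecidableEq ι] (μ : ι → α → ℝ) (i : ι) (f : (ι → α) → ℝ) (ω : ι → α) : ℝ :=
  ∑ x, μ i x * f (Function.update ω i x)

open Classical in
/-- The probability of the event `B`. -/
noncomputable def prob [Fintype ι] [Fintype α] [DecidableEq ι] (μ : ι → α → ℝ)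
    (B : Set (ι → α)) : ℝ :=
  expect μ fun ω => if ω ∈ B then 1 else 0

theorem avg_dependsOn [Fintype α] [DecidableEq ι] {i : ι} {s : Finset ι} {μ : ι → α → ℝ}
    {f : (ι → α) → ℝ} (hf : DependsOn f (insert i s : Finset ι)) :
    DependsOn (avg μ i f) (s : Set ι) := by
  intro x y hxy
  refine sum_congr rfl fun a _ => ?_
  congr 1
  refine hf fun j hj => ?_
  by_cases hji : j = i
  · subst hji; simp
  · have : j ∈ s := by simpa [hji] using hj
    simp [Function.update_of_ne hji, hxy j this]

theorem dependsOn_prod {β : Type*} {T : Finset β} {f : β → (ι → α) → ℝ} {s : β → Finset ι}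
    [DecidableEq ι] (hf : ∀ b ∈ T, DependsOn (f b) (s b : Set ι)) :
    DependsOn (fun ω => ∏ b ∈ T, f b ω) (T.biUnion s : Set ι) := by
  intro x y hxy
  refine prod_congr rfl fun b hb => hf b hb fun i hi => hxy i ?_
  exact mem_coe.2 (mem_biUnion.2 ⟨b, hb, hi⟩)

/-- The law of independent bits with `P(ω i = true) = q i`. -/
def bernoulli (q : ι → ℝ) (i : ι) (b : Bool) : ℝ := if b then q i else 1 - q i

theorem isWeight_bernoulli {q : ι → ℝ} (h0 : ∀ i, 0 ≤ q i) (h1 : ∀ i, q i ≤ 1) :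
    IsWeight (bernoulli q) where
  nonneg i x := by
    cases x
    · simpa [bernoulli] using h1 i
    · simpa [bernoulli] using h0 i
  sum_eq_one i := by simp [bernoulli]

theorem exp_bernoulli_le {q x y : ℝ} (h0 : 0 ≤ q) (hxy : |x - y| ≤ 1) :
    q * Real.exp x + (1 - q) * Real.exp y ≤
      Real.exp (q * x + (1 - q) * y + q * (x - y) ^ 2) := by
  have h1 : Real.exp x = Real.exp y * Real.exp (x - y) := by rw [← Real.exp_add]; congr 1; ring
  have h2 := (abs_le.1 (Real.abs_exp_sub_one_sub_id_le hxy)).2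
  have h3 : Real.exp (q * x + (1 - q) * y + q * (x - y) ^ 2) =
      Real.exp y * Real.exp (q * ((x - y) + (x - y) ^ 2)) := by
    rw [← Real.exp_add]; congr 1; ring
  have h4 := Real.add_one_le_exp (q * ((x - y) + (x - y) ^ 2))
  rw [h3, h1]
  have h5 : q * Real.exp (x - y) + (1 - q) ≤ Real.exp (q * ((x - y) + (x - y) ^ 2)) := by
    have := mul_le_mul_of_nonneg_left h2 h0
    linarith
  calc _ = Real.exp y * (q * Real.exp (x - y) + (1 - q)) := by ring
    _ ≤ _ := mul_le_mul_of_nonneg_left h5 (Real.exp_pos y).le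

variable [Fintype ι] [Fintype α] [DecidableEq ι] {μ : ι → α → ℝ} {f g : (ι → α) → ℝ}

theorem expect_avg (hμ : IsWeight μ) (i : ι) (f : (ι → α) → ℝ) :
    expect μ (avg μ i f) = expect μ f := by
  have hw : ∀ (ω : ι → α) (x : α), (∏ j, μ j (ω j)) * μ i x =
      (∏ j, μ j (Function.update ω i x j)) * μ i (ω i) := by
    intro ω x
    rw [← mul_prod_erase univ _ (mem_univ i), ← mul_prod_erase univ
      (fun j => μ j (Function.update ω i x j)) (mem_univ i)]
    have : ∏ j ∈ univ.erase i, μ j (Function.update ω i x j) = ∏ j ∈ univ.erase i, μ j (ω j) :=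
      prod_congr rfl fun j hj => by rw [Function.update_of_ne (ne_of_mem_erase hj)]
    rw [this, Function.update_self]
    ring
  let e : ((ι → α) × α) ≃ ((ι → α) × α) :=
    { toFun := fun z => (Function.update z.1 i z.2, z.1 i)
      invFun := fun z => (Function.update z.1 i z.2, z.1 i)
      left_inv := fun z => by simp
      right_inv := fun z => by simp }
  calc expect μ (avg μ i f)
      = ∑ z : (ι → α) × α, (∏ j, μ j ((e z).1 j)) * μ i (e z).2 * f (e z).1 := by
        rw [Fintype.sum_prod_type]
        refine sum_congr rfl fun ω _ => ?_
        simp only [avg, mul_sum, e, Equiv.coe_fn_mk]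
        refine sum_congr rfl fun x _ => ?_
        rw [← mul_assoc, hw]
    _ = ∑ z : (ι → α) × α, (∏ j, μ j (z.1 j)) * μ i z.2 * f z.1 :=
        e.sum_comp fun z => (∏ j, μ j (z.1 j)) * μ i z.2 * f z.1
    _ = expect μ f := by
        rw [Fintype.sum_prod_type]
        refine sum_congr rfl fun ω _ => ?_
        simp only
        rw [← sum_mul, ← mul_sum, hμ.sum_eq_one, mul_one]

theorem expect_mono (hμ : IsWeight μ) (h : ∀ ω, f ω ≤ g ω) : expect μ f ≤ expect μ g :=
  sum_le_sum fun ω _ => mul_le_mul_of_nonneg_left (h ω) (prod_nonneg fun i _ => hμ.nonneg i _)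

theorem expect_const (hμ : IsWeight μ) (a : ℝ) : expect μ (fun _ => a) = a := by
  have := (Finset.prod_univ_sum (fun _ : ι => (univ : Finset α)) μ).symm
  simp only [Fintype.piFinset_univ, hμ.sum_eq_one, prod_const_one] at this
  rw [expect, ← sum_mul, this, one_mul]

theorem expect_nonneg (hμ : IsWeight μ) (h : ∀ ω, 0 ≤ f ω) : 0 ≤ expect μ f :=
  sum_nonneg fun ω _ => mul_nonneg (prod_nonneg fun i _ => hμ.nonneg i _) (h ω)

theorem expect_add (f g : (ι → α) → ℝ) :
    expect μ (fun ω => f ω + g ω) = expect μ f + expect μ g := by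
  simp [expect, mul_add, sum_add_distrib]

theorem expect_const_mul (a : ℝ) (f : (ι → α) → ℝ) :
    expect μ (fun ω => a * f ω) = a * expect μ f := by
  simp only [expect, mul_sum]
  exact sum_congr rfl fun ω _ => by ring

theorem expect_sub (f g : (ι → α) → ℝ) :
    expect μ (fun ω => f ω - g ω) = expect μ f - expect μ g := by
  simp [expect, mul_sub, sum_sub_distrib]

theorem expect_sum {β : Type*} (T : Finset β) (f : β → (ι → α) → ℝ) :
    expect μ (fun ω => ∑ b ∈ T, f b ω) = ∑ b ∈ T, expect μ (f b) := by
  simp only [expect, mul_sum]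
  exact sum_comm

theorem eq_expect_of_dependsOn_empty (hμ : IsWeight μ) (hf : DependsOn f (∅ : Set ι))
    (ω : ι → α) : f ω = expect μ f := by
  have : f = fun _ => f ω := by
    ext ω'
    exact hf (by simp)
  rw [this, expect_const hμ]

/-- Functions of disjoint sets of coordinates are independent. -/
theorem expect_mul (hμ : IsWeight μ) {s t : Finset ι} (hst : Disjoint s t)
    (hf : DependsOn f (s : Set ι)) (hg : DependsOn g (t : Set ι)) :
    expect μ (fun ω => f ω * g ω) = expect μ f * expect μ g := by
  induction s using Finset.induction_on generalizing f with
  | empty =>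
    have hf' := eq_expect_of_dependsOn_empty hμ (by simpa using hf)
    simp only [hf']
    rw [expect_const_mul]
  | insert i s hi ih =>
    rw [disjoint_insert_left] at hst
    rw [← expect_avg hμ i, ← expect_avg hμ i f, ← ih hst.2 (avg_dependsOn hf)]
    congr 1
    ext ω
    simp only [avg, sum_mul]
    refine sum_congr rfl fun x _ => ?_
    have : g (Function.update ω i x) = g ω := hg fun j hj => by
      rw [Function.update_of_ne]
      rintro rfl
      exact hst.1 hj
    rw [this, mul_assoc]

theorem expect_prod (hμ : IsWeight μ) {β : Type*} [DecidableEq β] (T : Finset β)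
    (f : β → (ι → α) → ℝ) (s : β → Finset ι) (hf : ∀ b ∈ T, DependsOn (f b) (s b : Set ι))
    (hs : ∀ b ∈ T, ∀ b' ∈ T, b ≠ b' → Disjoint (s b) (s b')) :
    expect μ (fun ω => ∏ b ∈ T, f b ω) = ∏ b ∈ T, expect μ (f b) := by
  induction T using Finset.induction_on with
  | empty => simp [expect_const hμ]
  | insert b T hb ih =>
    simp only [prod_insert hb]
    rw [← ih (fun b' hb' => hf b' (mem_insert_of_mem hb'))
      fun b₁ h₁ b₂ h₂ => hs b₁ (mem_insert_of_mem h₁) b₂ (mem_insert_of_mem h₂)]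
    refine expect_mul hμ (s := s b) (t := T.biUnion s) ?_ (hf b (mem_insert_self b T))
      (dependsOn_prod fun b' hb' => hf b' (mem_insert_of_mem hb'))
    rw [disjoint_biUnion_right]
    intro b' hb'
    exact hs b (mem_insert_self b T) b' (mem_insert_of_mem hb') (by rintro rfl; exact hb hb')

theorem expect_coordinate (hμ : IsWeight μ) (i : ι) (g : α → ℝ) :
    expect μ (fun ω => g (ω i)) = ∑ x, μ i x * g x := by
  have : avg μ i (fun ω => g (ω i)) = fun _ => ∑ x, μ i x * g x := by
    ext ω; simp [avg]
  rw [← expect_avg hμ i, this, expect_const hμ]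

theorem expect_prod_coordinates (hμ : IsWeight μ) (T : Finset ι) (g : ι → α → ℝ) :
    expect μ (fun ω => ∏ i ∈ T, g i (ω i)) = ∏ i ∈ T, ∑ x, μ i x * g i x := by
  rw [expect_prod hμ T (fun i ω => g i (ω i)) (fun i => {i})]
  · exact prod_congr rfl fun i _ => expect_coordinate hμ i (g i)
  · intro i _ x y hxy
    exact congrArg (g i) (hxy i (by simp))
  · intro i _ j _ hij
    simpa using hij

theorem prob_mono (hμ : IsWeight μ) {A B : Set (ι → α)} (h : A ⊆ B) : prob μ A ≤ prob μ B := by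
  refine expect_mono hμ fun ω => ?_
  by_cases hA : ω ∈ A
  · simp [hA, h hA]
  · simp only [hA, if_false]
    split_ifs <;> norm_num

theorem prob_union_le (hμ : IsWeight μ) (A B : Set (ι → α)) :
    prob μ (A ∪ B) ≤ prob μ A + prob μ B := by
  rw [prob, prob, prob, ← expect_add]
  refine expect_mono hμ fun ω => ?_
  by_cases hA : ω ∈ A <;> by_cases hB : ω ∈ B <;> simp [hA, hB]

open Classical in
theorem prob_biUnion_le (hμ : IsWeight μ) {β : Type*} (T : Finset β) (B : β → Set (ι → α)) :
    prob μ (⋃ b ∈ T, B b) ≤ ∑ b ∈ T, prob μ (B b) := by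
  simp only [prob]
  rw [← expect_sum]
  refine expect_mono hμ fun ω => ?_
  split_ifs with h
  · simp only [Set.mem_iUnion] at h
    obtain ⟨b, hb, hω⟩ := h
    refine le_trans ?_ (single_le_sum (f := fun b => if ω ∈ B b then (1 : ℝ) else 0)
      (fun _ _ => by split_ifs <;> norm_num) hb)
    simp [hω]
  · exact sum_nonneg fun _ _ => by split_ifs <;> norm_num

/-- The exponential Markov inequality. -/
theorem prob_ge_le_exp (hμ : IsWeight μ) (f : (ι → α) → ℝ) (t : ℝ) :
    prob μ {ω | t ≤ f ω} ≤ Real.exp (-t) * expect μ (fun ω => Real.exp (f ω)) := by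
  rw [prob, ← expect_const_mul]
  refine expect_mono hμ fun ω => ?_
  rw [← Real.exp_add]
  split_ifs with h
  · exact Real.one_le_exp (by simp only [Set.mem_ofPred_eq] at h; linarith)
  · positivity

/-! ### The Lovász local lemma -/

open Classical in
/-- The probability that no event `B b` with `b ∈ T` occurs. -/
noncomputable def avoid {β : Type*} (μ : ι → α → ℝ) (B : β → Set (ι → α)) (T : Finset β) : ℝ :=
  expect μ fun ω => ∏ b ∈ T, if ω ∈ B b then 0 else 1

theorem avoid_nonneg {β : Type*} (hμ : IsWeight μ) (B : β → Set (ι → α)) (T : Finset β) :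
    0 ≤ avoid μ B T :=
  expect_nonneg hμ fun ω => prod_nonneg fun b _ => by split_ifs <;> norm_num

theorem avoid_union_ge {β : Type*} [DecidableEq β] (B : β → Set (ι → α))
    {x : ℝ} (hx : x ≤ 1) (T R : Finset β)
    (h : ∀ R' ⊆ R, ∀ b ∈ R, b ∉ R' → (1 - x) * avoid μ B (T ∪ R') ≤ avoid μ B (insert b (T ∪ R'))) :
    (1 - x) ^ R.card * avoid μ B T ≤ avoid μ B (T ∪ R) := by
  induction R using Finset.induction_on with
  | empty => simp
  | insert b R hb ih =>
    have h1 := ih fun R' hR' b' hb' hbR' =>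
      h R' (hR'.trans (subset_insert _ _)) b' (mem_insert_of_mem hb') hbR'
    have h2 := h R (subset_insert _ _) b (mem_insert_self _ _) hb
    rw [card_insert_of_notMem hb, union_insert, pow_succ']
    calc (1 - x) * (1 - x) ^ R.card * avoid μ B T
        = (1 - x) * ((1 - x) ^ R.card * avoid μ B T) := by ring
      _ ≤ (1 - x) * avoid μ B (T ∪ R) := mul_le_mul_of_nonneg_left h1 (by linarith)
      _ ≤ _ := h2

theorem avoid_insert_ge {β : Type*} [DecidableEq β] (hμ : IsWeight μ) (S : Finset β)
    (B : β → Set (ι → α)) (vbl : β → Finset ι)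
    (hB : ∀ b ∈ S, DependsOn (· ∈ B b) (vbl b : Set ι)) (Δ : ℕ) (hΔ : 0 < Δ)
    (hdeg : ∀ b ∈ S, (S.filter fun b' => ¬ Disjoint (vbl b) (vbl b')).card ≤ Δ)
    (hp : ∀ b ∈ S, prob μ (B b) ≤ 1 / (4 * Δ)) (T : Finset β) (hT : T ⊆ S) (b : β) (hb : b ∈ S)
    (hbT : b ∉ T) : (1 - 1 / (2 * Δ : ℝ)) * avoid μ B T ≤ avoid μ B (insert b T) := by
  classical
  induction hk : T.card using Nat.strong_induction_on generalizing T b with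
  | _ k ih =>
  subst hk
  have hΔ' : (1 : ℝ) ≤ Δ := by exact_mod_cast hΔ
  set x : ℝ := 1 / (2 * Δ) with hx
  have hx0 : 0 < x := by positivity
  have hxΔ : x * Δ = 1 / 2 := by rw [hx]; field_simp
  have hx1 : x ≤ 1 / 2 := by nlinarith
  let near := T.filter fun b' => ¬ Disjoint (vbl b) (vbl b')
  let far := T.filter fun b' => Disjoint (vbl b) (vbl b')
  have hunion : far ∪ near = T := filter_union_filter_not_eq _ _
  have hdisj : Disjoint far near := disjoint_filter_filter_not _ _ _
  have hnear : near.card ≤ Δ :=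
    (card_le_card (filter_subset_filter _ hT)).trans (hdeg b hb)
  have hfar : (1 - x) ^ near.card * avoid μ B far ≤ avoid μ B T := by
    have := avoid_union_ge (μ := μ) B (by linarith : x ≤ 1) far near ?_
    · rwa [hunion] at this
    · intro R hR b' hb' hb'R
      have hbT' : b' ∈ T := (mem_filter.1 hb').1
      have hbfar : b' ∉ far ∪ R := by
        rw [mem_union, not_or]
        exact ⟨fun h => disjoint_left.1 hdisj h hb', hb'R⟩
      have hsub : far ∪ R ⊆ T := by
        rw [← hunion]
        exact union_subset_union_right hR
      refine ih _ ?_ (far ∪ R) (hsub.trans hT) b' (hT hbT') hbfar rfl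
      exact card_lt_card ⟨hsub, fun h => hbfar (h hbT')⟩
  have hhalf : 1 / 2 ≤ (1 - x) ^ near.card := by
    have h1 := one_add_mul_le_pow (by linarith : (-2 : ℝ) ≤ -x) near.card
    have h2 : (near.card : ℝ) ≤ Δ := by exact_mod_cast hnear
    have h3 : (near.card : ℝ) * x ≤ Δ * x := mul_le_mul_of_nonneg_right h2 hx0.le
    rw [← sub_eq_add_neg] at h1
    nlinarith
  have hind : expect μ (fun ω => (if ω ∈ B b then 1 else 0) *
      ∏ b' ∈ far, if ω ∈ B b' then (0 : ℝ) else 1) = prob μ (B b) * avoid μ B far := by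
    refine expect_mul hμ (s := vbl b) (t := far.biUnion vbl) ?_ ?_ ?_
    · rw [disjoint_biUnion_right]
      exact fun b' hb' => (mem_filter.1 hb').2
    · intro ω ω' h
      have := hB b hb h
      simp only [this]
    · refine dependsOn_prod fun b' hb' ω ω' h => ?_
      have := hB b' (hT (mem_filter.1 hb').1) h
      simp only [this]
  have hbad : expect μ (fun ω => (if ω ∈ B b then 1 else 0) *
      ∏ b' ∈ T, if ω ∈ B b' then (0 : ℝ) else 1) ≤ prob μ (B b) * avoid μ B far := by
    rw [← hind]
    refine expect_mono hμ fun ω => mul_le_mul_of_nonneg_left ?_ (by split_ifs <;> norm_num)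
    exact prod_le_prod_of_subset_of_le_one (filter_subset _ _)
      (fun _ _ => by split_ifs <;> norm_num) fun _ _ _ => by split_ifs <;> norm_num
  have hsplit : avoid μ B (insert b T) = avoid μ B T - expect μ (fun ω =>
      (if ω ∈ B b then 1 else 0) * ∏ b' ∈ T, if ω ∈ B b' then (0 : ℝ) else 1) := by
    rw [avoid, avoid, ← expect_sub]
    congr 1
    ext ω
    rw [prod_insert hbT]
    split_ifs <;> ring
  have hpb := hp b hb
  have hpx : (1 : ℝ) / (4 * Δ) = x / 2 := by rw [hx]; field_simp; norm_num
  rw [hpx] at hpb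
  have h0 := avoid_nonneg hμ B far
  rw [hsplit]
  have h4 : prob μ (B b) * avoid μ B far ≤ x / 2 * avoid μ B far :=
    mul_le_mul_of_nonneg_right hpb h0
  have h5 : 1 / 2 * avoid μ B far ≤ (1 - x) ^ near.card * avoid μ B far :=
    mul_le_mul_of_nonneg_right hhalf h0
  nlinarith

/-- The symmetric Lovász local lemma for events in a product space. -/
theorem exists_avoiding {β : Type*} (hμ : IsWeight μ) (S : Finset β)
    (B : β → Set (ι → α)) (vbl : β → Finset ι)
    (hB : ∀ b ∈ S, DependsOn (· ∈ B b) (vbl b : Set ι)) (Δ : ℕ) (hΔ : 0 < Δ)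
    (hdeg : ∀ b ∈ S, (S.filter fun b' => ¬ Disjoint (vbl b) (vbl b')).card ≤ Δ)
    (hp : ∀ b ∈ S, prob μ (B b) ≤ 1 / (4 * Δ)) : ∃ ω, ∀ b ∈ S, ω ∉ B b := by
  classical
  have hΔ' : (1 : ℝ) ≤ Δ := by exact_mod_cast hΔ
  have hx : (1 : ℝ) / (2 * Δ) ≤ 1 / 2 := by
    rw [div_le_div_iff₀ (by positivity) (by positivity)]
    linarith
  have h := avoid_union_ge (μ := μ) B (by linarith : (1 : ℝ) / (2 * Δ) ≤ 1) ∅ S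
    fun R hR b hb hbR => by
      rw [empty_union]
      exact avoid_insert_ge hμ S B vbl hB Δ hΔ hdeg hp R hR b hb hbR
  have h1 : avoid μ B ∅ = 1 := by simp [avoid, expect_const hμ]
  rw [h1, mul_one, empty_union] at h
  have hpos : 0 < avoid μ B S := lt_of_lt_of_le (pow_pos (by linarith) _) h
  by_contra! hno
  have : avoid μ B S = 0 := by
    refine (congrArg (expect μ) (funext fun ω => ?_)).trans (expect_const hμ (0 : ℝ))
    obtain ⟨b, hb, hω⟩ := hno ω
    exact prod_eq_zero hb (by simp [hω])
  linarith

/-! ### Exponential moments on Boolean product spaces -/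

theorem expect_exp_le_of_dependsOn {q : ι → ℝ} (h0 : ∀ i, 0 ≤ q i) (h1 : ∀ i, q i ≤ 1)
    {c : ι → ℝ} (hc : ∀ i, c i ≤ 1) (s : Finset ι) (f : (ι → Bool) → ℝ)
    (hs : DependsOn f (s : Set ι))
    (hf : ∀ i ω, |f (Function.update ω i true) - f (Function.update ω i false)| ≤ c i) :
    expect (bernoulli q) (fun ω => Real.exp (f ω)) ≤
      Real.exp (expect (bernoulli q) f + ∑ i ∈ s, q i * c i ^ 2) := by
  have hμ := isWeight_bernoulli h0 h1
  induction s using Finset.induction_on generalizing f with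
  | empty =>
    have hf' := eq_expect_of_dependsOn_empty hμ (by simpa using hs)
    simp only [hf', expect_const hμ]
    simp
  | insert i s hi ih =>
    have havg : ∀ ω, avg (bernoulli q) i f ω = q i * f (Function.update ω i true) +
        (1 - q i) * f (Function.update ω i false) := by
      intro ω; simp [avg, bernoulli]
    have hlip : ∀ j ω, |avg (bernoulli q) i f (Function.update ω j true) -
        avg (bernoulli q) i f (Function.update ω j false)| ≤ c j := by
      intro j ω
      rw [havg, havg]
      by_cases hij : j = i
      · subst hij
        simp only [Function.update_idem, sub_self, abs_zero]
        exact (abs_nonneg _).trans (hf j ω)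
      · rw [Function.update_comm hij, Function.update_comm hij, Function.update_comm hij,
          Function.update_comm hij]
        have a1 := abs_le.1 (hf j (Function.update ω i true))
        have a2 := abs_le.1 (hf j (Function.update ω i false))
        have b0 := h0 i
        have b1 : 0 ≤ 1 - q i := sub_nonneg.2 (h1 i)
        rw [abs_le]
        constructor <;> nlinarith
    have key := ih (avg (bernoulli q) i f) (avg_dependsOn hs) hlip
    rw [expect_avg hμ] at key
    rw [sum_insert hi]
    calc expect (bernoulli q) (fun ω => Real.exp (f ω))
        = expect (bernoulli q) (avg (bernoulli q) i fun ω => Real.exp (f ω)) :=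
          (expect_avg hμ i _).symm
      _ ≤ expect (bernoulli q) (fun ω => Real.exp (q i * c i ^ 2) *
            Real.exp (avg (bernoulli q) i f ω)) := by
          refine expect_mono hμ fun ω => ?_
          have hd := hf i ω
          have h2 := exp_bernoulli_le (h0 i) (hd.trans (hc i))
          have h3 : (f (Function.update ω i true) - f (Function.update ω i false)) ^ 2 ≤
              c i ^ 2 := sq_le_sq' (abs_le.1 hd).1 (abs_le.1 hd).2
          have h4 := mul_le_mul_of_nonneg_left h3 (h0 i)
          rw [← Real.exp_add, havg]
          have : avg (bernoulli q) i (fun ω => Real.exp (f ω)) ω =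
            q i * Real.exp (f (Function.update ω i true)) +
              (1 - q i) * Real.exp (f (Function.update ω i false)) := by
            simp [avg, bernoulli]
          rw [this]
          exact h2.trans (Real.exp_le_exp.2 (by linarith))
      _ = Real.exp (q i * c i ^ 2) *
            expect (bernoulli q) (fun ω => Real.exp (avg (bernoulli q) i f ω)) :=
          expect_const_mul _ _
      _ ≤ Real.exp (q i * c i ^ 2) * Real.exp (expect (bernoulli q) f + ∑ i ∈ s, q i * c i ^ 2) :=
          mul_le_mul_of_nonneg_left key (Real.exp_pos _).le
      _ = _ := by rw [← Real.exp_add]; congr 1; ring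


/-! ### Counting coordinate sets on which all bits vanish -/

section Count

variable {ι β : Type*} [Fintype ι] [DecidableEq ι] {q : ι → ℝ}

theorem expect_forall_eq_false (h0 : ∀ i, 0 ≤ q i) (h1 : ∀ i, q i ≤ 1) (T : Finset ι) :
    expect (bernoulli q) (fun ω => if ∀ t ∈ T, ω t = false then 1 else 0) =
      ∏ t ∈ T, (1 - q t) := by
  have h : (fun ω : ι → Bool => if ∀ t ∈ T, ω t = false then (1 : ℝ) else 0) =
      fun ω => ∏ t ∈ T, if ω t = false then 1 else 0 := by
    ext ω
    rw [prod_boole]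
    congr
  rw [h, expect_prod_coordinates (isWeight_bernoulli h0 h1) T fun _ b => if b = false then 1 else 0]
  exact prod_congr rfl fun t _ => by simp [bernoulli]

/-- Exponential moments of the number of sets `T u` on which all bits vanish, when every
coordinate lies in at most `k` of these sets. -/
theorem expect_exp_count_le (h0 : ∀ i, 0 ≤ q i) (h1 : ∀ i, q i ≤ 1) (U : Finset β)
    (T : β → Finset ι) {k : ℕ} (hk : ∀ t, (U.filter fun u => t ∈ T u).card ≤ k) {M : ℝ}
    (hM : ∀ u ∈ U, ∑ t ∈ T u, q t ≤ M) {l : ℝ} (hl : |l| * k ≤ 1) :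
    expect (bernoulli q) (fun ω =>
        Real.exp (l * (U.filter fun u => ∀ t ∈ T u, ω t = false).card)) ≤
      Real.exp (l * ∑ u ∈ U, ∏ t ∈ T u, (1 - q t) + l ^ 2 * (k * (M * U.card))) := by
  classical
  let X : β → (ι → Bool) → ℝ := fun u ω => if ∀ t ∈ T u, ω t = false then 1 else 0
  have hX : ∀ ω : ι → Bool, ((U.filter fun u => ∀ t ∈ T u, ω t = false).card : ℝ) =
      ∑ u ∈ U, X u ω := fun ω => by simp [X]
  simp only [hX]
  have hE : expect (bernoulli q) (fun ω => l * ∑ u ∈ U, X u ω) =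
      l * ∑ u ∈ U, ∏ t ∈ T u, (1 - q t) := by
    rw [expect_const_mul, expect_sum]
    congr 1
    exact sum_congr rfl fun u _ => expect_forall_eq_false h0 h1 (T u)
  have hk' : ∀ t, ((U.filter fun u => t ∈ T u).card : ℝ) ≤ k := fun t => by exact_mod_cast hk t
  refine (expect_exp_le_of_dependsOn h0 h1 (c := fun t => |l| * (U.filter fun u => t ∈ T u).card)
    (fun t => (mul_le_mul_of_nonneg_left (hk' t) (abs_nonneg l)).trans hl) univ _
    ?_ fun t ω => ?_).trans ?_
  · intro x y hxy
    have : x = y := funext fun i => hxy i (by simp)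
    rw [this]
  · rw [← mul_sub, abs_mul, ← sum_sub_distrib]
    refine mul_le_mul_of_nonneg_left ?_ (abs_nonneg l)
    refine (abs_sum_le_sum_abs _ _).trans ?_
    rw [card_filter, Nat.cast_sum]
    refine sum_le_sum fun u _ => ?_
    by_cases ht : t ∈ T u
    · simp only [ht, if_true, X]
      split_ifs <;> norm_num
    · have : ∀ b, X u (Function.update ω t b) = X u ω := by
        intro b
        have : (∀ s ∈ T u, Function.update ω t b s = false) ↔ ∀ s ∈ T u, ω s = false := by
          refine forall₂_congr fun s hs => ?_
          rw [Function.update_of_ne (by rintro rfl; exact ht hs)]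
        simp only [X, this]
      simp [this, ht]
  · rw [hE]
    refine Real.exp_le_exp.2 (add_le_add le_rfl ?_)
    calc ∑ t, q t * (|l| * (U.filter fun u => t ∈ T u).card) ^ 2
        ≤ ∑ t, l ^ 2 * (k * ∑ u ∈ U, if t ∈ T u then q t else 0) := by
          refine sum_le_sum fun t _ => ?_
          have hs : ∑ u ∈ U, (if t ∈ T u then q t else 0) =
              (U.filter fun u => t ∈ T u).card * q t := by
            rw [← sum_filter, sum_const, nsmul_eq_mul]
          rw [hs, mul_pow, sq_abs]
          have h2 := mul_le_mul_of_nonneg_right (hk' t)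
            (mul_nonneg (mul_nonneg (sq_nonneg l) (h0 t))
              (Nat.cast_nonneg (α := ℝ) (U.filter fun u => t ∈ T u).card))
          linarith
      _ = l ^ 2 * (k * ∑ u ∈ U, ∑ t ∈ T u, q t) := by
          rw [← mul_sum, ← mul_sum, sum_comm]
          congr 2
          refine sum_congr rfl fun u _ => ?_
          rw [← sum_filter, filter_mem_eq_inter, univ_inter]
      _ ≤ l ^ 2 * (k * (M * U.card)) := by
          refine mul_le_mul_of_nonneg_left (mul_le_mul_of_nonneg_left ?_ (Nat.cast_nonneg k))
            (sq_nonneg l)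
          refine (sum_le_sum hM).trans ?_
          rw [sum_const, nsmul_eq_mul, mul_comm]

theorem prob_count_ge_le (h0 : ∀ i, 0 ≤ q i) (h1 : ∀ i, q i ≤ 1) (U : Finset β)
    (T : β → Finset ι) {k : ℕ} (hk : ∀ t, (U.filter fun u => t ∈ T u).card ≤ k) {M : ℝ}
    (hM0 : 0 ≤ M) (hM : ∀ u ∈ U, ∑ t ∈ T u, q t ≤ M) {l : ℝ} (hl0 : 0 ≤ l) (hl : l * k ≤ 1)
    {x η m : ℝ} (hx0 : 0 ≤ x) (hx : ∀ u ∈ U, ∏ t ∈ T u, (1 - q t) ≤ x) (hm : U.card ≤ m) :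
    prob (bernoulli q)
        {ω | (x + η) * m ≤ (U.filter fun u => ∀ t ∈ T u, ω t = false).card} ≤
      Real.exp (-(l * η * m) + l ^ 2 * (k * (M * m))) := by
  have hμ := isWeight_bernoulli h0 h1
  have hmoment := expect_exp_count_le h0 h1 U T hk hM (l := l) (by rwa [abs_of_nonneg hl0])
  have hsum : ∑ u ∈ U, ∏ t ∈ T u, (1 - q t) ≤ m * x := by
    refine (sum_le_sum hx).trans ?_
    rw [sum_const, nsmul_eq_mul]
    exact mul_le_mul_of_nonneg_right hm hx0
  refine (prob_mono hμ (B := {ω | l * ((x + η) * m) ≤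
    l * (U.filter fun u => ∀ t ∈ T u, ω t = false).card})
    fun ω hω => mul_le_mul_of_nonneg_left hω hl0).trans ?_
  refine (prob_ge_le_exp hμ _ _).trans ?_
  refine (mul_le_mul_of_nonneg_left hmoment (Real.exp_pos _).le).trans ?_
  rw [← Real.exp_add]
  refine Real.exp_le_exp.2 ?_
  have a1 := mul_le_mul_of_nonneg_left hsum hl0
  have a2 : l ^ 2 * (k * (M * U.card)) ≤ l ^ 2 * (k * (M * m)) := by gcongr
  linarith

theorem prob_count_le_le (h0 : ∀ i, 0 ≤ q i) (h1 : ∀ i, q i ≤ 1) (U : Finset β)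
    (T : β → Finset ι) {k : ℕ} (hk : ∀ t, (U.filter fun u => t ∈ T u).card ≤ k) {M : ℝ}
    (hM : ∀ u ∈ U, ∑ t ∈ T u, q t ≤ M) {l : ℝ} (hl0 : 0 ≤ l) (hl : l * k ≤ 1)
    {x η : ℝ} (hx : ∀ u ∈ U, x ≤ ∏ t ∈ T u, (1 - q t)) :
    prob (bernoulli q)
        {ω | (U.filter fun u => ∀ t ∈ T u, ω t = false).card ≤ (x - η) * U.card} ≤
      Real.exp (-(l * η * U.card) + l ^ 2 * (k * (M * U.card))) := by
  have hμ := isWeight_bernoulli h0 h1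
  have hmoment := expect_exp_count_le h0 h1 U T hk hM (l := -l)
    (by rwa [abs_neg, abs_of_nonneg hl0])
  have hsum : U.card * x ≤ ∑ u ∈ U, ∏ t ∈ T u, (1 - q t) := by
    refine le_trans ?_ (sum_le_sum hx)
    rw [sum_const, nsmul_eq_mul]
  refine (prob_mono hμ (B := {ω | -l * ((x - η) * U.card) ≤
    -l * (U.filter fun u => ∀ t ∈ T u, ω t = false).card})
    fun ω hω => mul_le_mul_of_nonpos_left hω (neg_nonpos.2 hl0)).trans ?_
  refine (prob_ge_le_exp hμ _ _).trans ?_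
  refine (mul_le_mul_of_nonneg_left hmoment (Real.exp_pos _).le).trans ?_
  rw [← Real.exp_add]
  refine Real.exp_le_exp.2 ?_
  have a1 := mul_le_mul_of_nonneg_left hsum hl0
  linarith

end Count

/-! ### Conflicts in a random colour assignment -/

section Conflicts

variable {V K : Type*} [Fintype V] [DecidableEq V] [Fintype K] [DecidableEq K]
  {q : V × K × Bool → ℝ} {a : ℝ}

theorem expect_pair_mul_exp_le (h0 : ∀ i, 0 ≤ q i) (h1 : ∀ i, q i ≤ 1) (γ : K)
    (ha : ∀ v, q (v, γ, false) = a) (U : Finset V) {d : ℝ} (hd : U.card ≤ d)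
    (had : 2 * a * d ≤ 1) {u w : V} (huw : u ≠ w) :
    expect (bernoulli q) (fun ω => if ω (u, γ, false) = true ∧ ω (w, γ, false) = true then
      Real.exp (U.filter fun x => ω (x, γ, false) = true).card else 0) ≤ 21 * a ^ 2 := by
  have hμ := isWeight_bernoulli h0 h1
  have ha0 : 0 ≤ a := ha u ▸ h0 _
  let P : Finset V := {u, w}
  let e := Real.exp 1
  have he1 : 1 ≤ e := Real.one_le_exp zero_le_one
  have he3 : e < 2.7182818286 := Real.exp_one_lt_d9
  let g : V → Bool → ℝ := fun x b => if b then e else if x ∈ P then 0 else 1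
  have hg0 : ∀ x b, 0 ≤ g x b := fun x b => by
    simp only [g]; split_ifs <;> linarith
  have hpoint : ∀ ω : V × K × Bool → Bool,
      (if ω (u, γ, false) = true ∧ ω (w, γ, false) = true then
        Real.exp (U.filter fun x => ω (x, γ, false) = true).card else 0) ≤
      ∏ x ∈ U ∪ P, g x (ω (x, γ, false)) := by
    intro ω
    split_ifs with h
    · have hx : ∀ x, g x (ω (x, γ, false)) = if ω (x, γ, false) = true then e else 1 := by
        intro x
        simp only [g]
        split_ifs with h2 h3
        · rfl
        · simp only [P, mem_insert, mem_singleton] at h3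
          rcases h3 with rfl | rfl
          · exact absurd h.1 h2
          · exact absurd h.2 h2
        · rfl
      simp only [hx]
      rw [← prod_filter, prod_const, ← Real.exp_nat_mul, mul_one]
      refine Real.exp_le_exp.2 (Nat.cast_le.2 (card_le_card (filter_subset_filter _ ?_)))
      exact subset_union_left
    · exact prod_nonneg fun x _ => hg0 x _
  refine (expect_mono hμ hpoint).trans ?_
  rw [expect_prod hμ (U ∪ P) (fun x ω => g x (ω (x, γ, false))) fun x => {(x, γ, false)}]
  rotate_left
  · intro x _ ω ω' h
    exact congrArg (g x) (h _ (by simp))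
  · intro x _ y _ hxy
    simpa using hxy
  have hcoord : ∀ x, expect (bernoulli q) (fun ω => g x (ω (x, γ, false))) =
      a * e + (1 - a) * if x ∈ P then 0 else 1 := by
    intro x
    rw [expect_coordinate hμ]
    simp [bernoulli, g, ha]
  simp only [hcoord]
  rw [union_comm, ← union_sdiff_self_eq_union, prod_union disjoint_sdiff]
  have hP : ∏ x ∈ P, (a * e + (1 - a) * if x ∈ P then 0 else 1) = (a * e) ^ 2 := by
    rw [prod_congr rfl (g := fun _ => a * e) fun x hx => by simp [hx], prod_const,
      card_pair huw]
  have hU : ∏ x ∈ U \ P, (a * e + (1 - a) * if x ∈ P then 0 else 1) ≤ e := by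
    calc _ ≤ ∏ x ∈ U \ P, Real.exp (2 * a) := by
          refine prod_le_prod (fun x hx => ?_) fun x hx => ?_
          all_goals rw [if_neg (mem_sdiff.1 hx).2]
          · nlinarith [h1 (u, γ, false), ha u]
          · refine le_trans ?_ (Real.add_one_le_exp (2 * a))
            nlinarith
      _ = Real.exp ((U \ P).card * (2 * a)) := by rw [prod_const, Real.exp_nat_mul]
      _ ≤ e := by
          refine Real.exp_le_exp.2 ?_
          have : ((U \ P).card : ℝ) ≤ d :=
            le_trans (Nat.cast_le.2 (card_le_card sdiff_subset)) hd
          nlinarith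
  rw [hP]
  calc _ ≤ (a * e) ^ 2 * e := mul_le_mul_of_nonneg_left hU (sq_nonneg _)
    _ = a ^ 2 * e ^ 3 := by ring
    _ ≤ a ^ 2 * 21 := by
        refine mul_le_mul_of_nonneg_left ?_ (sq_nonneg _)
        calc e ^ 3 ≤ 2.7182818286 ^ 3 := by gcongr
          _ ≤ 21 := by norm_num
    _ = _ := mul_comm _ _

theorem expect_exp_colour_conflicts_le (h0 : ∀ i, 0 ≤ q i) (h1 : ∀ i, q i ≤ 1) (γ : K)
    (ha : ∀ v, q (v, γ, false) = a) (U U' : Finset V) (hU : U' ⊆ U) {d : ℝ} (hd : U.card ≤ d)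
    (had : 2 * a * d ≤ 1) (N : V → Finset V) (hN : ∀ u, u ∉ N u) {m : ℝ}
    (hm : ∀ u ∈ U', ((N u).card : ℝ) ≤ m) :
    expect (bernoulli q) (fun ω => Real.exp (U'.filter fun u => ω (u, γ, false) = true ∧
      ∃ w ∈ N u, ω (w, γ, false) = true).card) ≤ Real.exp (U'.card * (m * (21 * a ^ 2))) := by
  have hμ := isWeight_bernoulli h0 h1
  let Z : (V × K × Bool → Bool) → ℝ := fun ω =>
    Real.exp (U.filter fun x => ω (x, γ, false) = true).card
  have hpoint : ∀ ω : V × K × Bool → Bool, Real.exp (U'.filter fun u => ω (u, γ, false) = true ∧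
      ∃ w ∈ N u, ω (w, γ, false) = true).card ≤ 1 + ∑ u ∈ U', ∑ w ∈ N u,
        if ω (u, γ, false) = true ∧ ω (w, γ, false) = true then Z ω else 0 := by
    intro ω
    set Y := U'.filter fun u => ω (u, γ, false) = true ∧ ∃ w ∈ N u, ω (w, γ, false) = true
    have hYZ : Real.exp Y.card ≤ Z ω := by
      refine Real.exp_le_exp.2 (Nat.cast_le.2 (card_le_card fun u hu => ?_))
      obtain ⟨hu1, hu2, -⟩ := mem_filter.1 hu
      exact mem_filter.2 ⟨hU hu1, hu2⟩
    have hexp : Real.exp Y.card ≤ 1 + Y.card * Real.exp Y.card := by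
      have h2 := Real.add_one_le_exp (-(Y.card : ℝ))
      have h3 : Real.exp (-(Y.card : ℝ)) * Real.exp Y.card = 1 := by
        rw [← Real.exp_add]; simp
      nlinarith [Real.exp_pos (Y.card : ℝ)]
    have hsum : Y.card * Z ω ≤ ∑ u ∈ U', ∑ w ∈ N u,
        if ω (u, γ, false) = true ∧ ω (w, γ, false) = true then Z ω else 0 := by
      rw [← nsmul_eq_mul, ← sum_const, sum_filter]
      refine sum_le_sum fun u _ => ?_
      have hnn : ∀ w ∈ N u, 0 ≤ if ω (u, γ, false) = true ∧ ω (w, γ, false) = true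
          then Z ω else 0 := fun w _ => by
        split_ifs
        · exact (Real.exp_pos _).le
        · exact le_rfl
      split_ifs with h
      · obtain ⟨hu, w, hw, hw'⟩ := h
        refine le_trans ?_ (single_le_sum hnn hw)
        rw [if_pos ⟨hu, hw'⟩]
      · exact sum_nonneg hnn
    have : Y.card * Real.exp Y.card ≤ Y.card * Z ω :=
      mul_le_mul_of_nonneg_left hYZ (Nat.cast_nonneg _)
    linarith
  refine (expect_mono hμ hpoint).trans ?_
  rw [expect_add, expect_const hμ, expect_sum]
  simp only [expect_sum]
  refine le_trans ?_ (Real.add_one_le_exp _)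
  rw [add_comm]
  refine add_le_add ?_ le_rfl
  rw [← nsmul_eq_mul, ← sum_const]
  refine sum_le_sum fun u hu => ?_
  calc _ ≤ ∑ w ∈ N u, 21 * a ^ 2 := by
        refine sum_le_sum fun w hw => ?_
        exact expect_pair_mul_exp_le h0 h1 γ ha U hd had (by rintro rfl; exact hN u hw)
    _ ≤ _ := by
        rw [sum_const, nsmul_eq_mul]
        exact mul_le_mul_of_nonneg_right (hm u hu) (by positivity)

/-- Exponential moments of the number of vertices of `U` that receive some colour together with
one of their neighbours. -/
theorem expect_exp_conflicts_le (h0 : ∀ i, 0 ≤ q i) (h1 : ∀ i, q i ≤ 1)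
    (ha : ∀ v γ, q (v, γ, false) = a) (U : Finset V) {d : ℝ} (hd : U.card ≤ d)
    (had : 2 * a * d ≤ 1) (N : V → K → Finset V) (hN : ∀ u γ, u ∉ N u γ) {m : ℝ}
    (hm0 : 0 ≤ m) (L : V → Finset K) {n : ℕ} (hL : ∀ u ∈ U, (L u).card ≤ n)
    (hm : ∀ u ∈ U, ∀ γ ∈ L u, ((N u γ).card : ℝ) ≤ m) :
    expect (bernoulli q) (fun ω => Real.exp (U.filter fun u => ∃ γ ∈ L u,
      ω (u, γ, false) = true ∧ ∃ w ∈ N u γ, ω (w, γ, false) = true).card) ≤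
        Real.exp (d * n * (m * (21 * a ^ 2))) := by
  have hμ := isWeight_bernoulli h0 h1
  let W : K → Finset V := fun γ => U.filter fun u => γ ∈ L u
  let Y : K → (V × K × Bool → Bool) → Finset V := fun γ ω => (W γ).filter fun u =>
    ω (u, γ, false) = true ∧ ∃ w ∈ N u γ, ω (w, γ, false) = true
  have hpoint : ∀ ω : V × K × Bool → Bool, Real.exp (U.filter fun u => ∃ γ ∈ L u,
      ω (u, γ, false) = true ∧ ∃ w ∈ N u γ, ω (w, γ, false) = true).card ≤
      ∏ γ, Real.exp (Y γ ω).card := by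
    intro ω
    rw [← Real.exp_sum, ← Nat.cast_sum]
    refine Real.exp_le_exp.2 (Nat.cast_le.2 (le_trans (card_le_card fun u hu => ?_)
      (card_biUnion_le (s := univ) (t := fun γ => Y γ ω))))
    obtain ⟨hu1, γ, hγ, h⟩ := mem_filter.1 hu
    exact mem_biUnion.2 ⟨γ, mem_univ γ, mem_filter.2 ⟨mem_filter.2 ⟨hu1, hγ⟩, h⟩⟩
  refine (expect_mono hμ hpoint).trans ?_
  rw [expect_prod hμ univ (fun γ ω => Real.exp (Y γ ω).card)
    fun γ => univ.filter fun t => t.2.1 = γ]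
  rotate_left
  · intro γ _ ω ω' h
    have h' : ∀ x, ω (x, γ, false) = ω' (x, γ, false) := fun x => h _ (by simp)
    simp only [Y, h']
  · intro γ _ γ' _ hne
    refine disjoint_filter.2 fun t _ h h' => hne (h.symm.trans h')
  calc _ ≤ ∏ γ, Real.exp ((W γ).card * (m * (21 * a ^ 2))) := by
        refine prod_le_prod (fun γ _ => expect_nonneg hμ fun ω => (Real.exp_pos _).le)
          fun γ _ => ?_
        exact expect_exp_colour_conflicts_le h0 h1 γ (fun v => ha v γ) U (W γ)
          (filter_subset _ _) hd had (fun u => N u γ) (fun u => hN u γ)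
          fun u hu => hm u (mem_filter.1 hu).1 γ (mem_filter.1 hu).2
    _ = Real.exp ((∑ γ, (W γ).card : ℕ) * (m * (21 * a ^ 2))) := by
        rw [← Real.exp_sum, Nat.cast_sum, sum_mul]
    _ ≤ _ := by
        refine Real.exp_le_exp.2 (mul_le_mul_of_nonneg_right ?_ (by positivity))
        have h2 : ∑ γ, (W γ).card = ∑ u ∈ U, (L u).card := by
          simp only [W, card_filter]
          rw [sum_comm]
          exact sum_congr rfl fun u _ => by simp
        rw [h2, Nat.cast_sum]
        calc ∑ u ∈ U, ((L u).card : ℝ) ≤ ∑ u ∈ U, (n : ℝ) :=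
              sum_le_sum fun u hu => Nat.cast_le.2 (hL u hu)
          _ = U.card * n := by rw [sum_const, nsmul_eq_mul]
          _ ≤ d * n := mul_le_mul_of_nonneg_right hd (Nat.cast_nonneg n)

end Conflicts

end ProductSpace

namespace ListNibble

open ProductSpace

section Setup

variable {V J K : Type*} [DecidableEq V] [Fintype J] [DecidableEq K]

/-! ### Nearly disjoint families and colour neighbourhoods -/

/-- `G i` are graphs living on vertex sets `S i` that pairwise share at most one vertex, and each
vertex is in at most `C` of these sets. -/
structure NearlyDisjoint (G : J → SimpleGraph V) (S : J → Finset V) (C : ℕ) : Prop where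
  mem_left : ∀ {i u v}, (G i).Adj u v → u ∈ S i
  mem_right : ∀ {i u v}, (G i).Adj u v → v ∈ S i
  eq_of_mem : ∀ {i j u v}, i ≠ j → u ∈ S i → u ∈ S j → v ∈ S i → v ∈ S j → u = v
  card_le : ∀ v, (univ.filter fun i => v ∈ S i).card ≤ C

/-- The restriction of the graph `H` to `W` is colourable from the lists `L`. -/
def IsColourable (H : SimpleGraph V) (W : Finset V) (L : V → Finset K) : Prop :=
  ∃ φ : V → K, (∀ v ∈ W, φ v ∈ L v) ∧ ∀ u ∈ W, ∀ v ∈ W, H.Adj u v → φ u ≠ φ v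

open Classical in
/-- The neighbours of `v` in `W` whose list contains the colour `c`. -/
noncomputable def colourNbrs (H : SimpleGraph V) (W : Finset V) (L : V → Finset K) (v : V)
    (c : K) : Finset V :=
  W.filter fun u => H.Adj v u ∧ c ∈ L u

omit [DecidableEq V] in
theorem mem_colourNbrs {H : SimpleGraph V} {W : Finset V} {L : V → Finset K} {u v : V} {c : K} :
    u ∈ colourNbrs H W L v c ↔ u ∈ W ∧ H.Adj v u ∧ c ∈ L u := by
  classical
  simp [colourNbrs]

theorem card_colourNbrs_iSup_le {G : J → SimpleGraph V} {S : J → Finset V} {C : ℕ}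
    (hG : NearlyDisjoint G S C) {W : Finset V} {L : V → Finset K} {v : V} {c : K} {d : ℝ}
    (hd0 : 0 ≤ d) (hd : ∀ i, ((colourNbrs (G i) W L v c).card : ℝ) ≤ d) :
    ((colourNbrs (⨆ i, G i) W L v c).card : ℝ) ≤ C * d := by
  have hsub : colourNbrs (⨆ i, G i) W L v c ⊆
      (univ.filter fun i => v ∈ S i).biUnion fun i => colourNbrs (G i) W L v c := by
    intro u hu
    rw [mem_colourNbrs, SimpleGraph.iSup_adj] at hu
    obtain ⟨huW, ⟨i, hi⟩, hc⟩ := hu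
    simp only [mem_biUnion, mem_filter, mem_univ, true_and]
    exact ⟨i, hG.mem_left hi, mem_colourNbrs.2 ⟨huW, hi, hc⟩⟩
  calc ((colourNbrs (⨆ i, G i) W L v c).card : ℝ)
      ≤ ∑ i ∈ univ.filter fun i => v ∈ S i, ((colourNbrs (G i) W L v c).card : ℝ) := by
        exact_mod_cast (card_le_card hsub).trans card_biUnion_le
    _ ≤ ∑ i ∈ univ.filter fun i => v ∈ S i, d := sum_le_sum fun i _ => hd i
    _ ≤ C * d := by
        rw [sum_const, nsmul_eq_mul]
        exact mul_le_mul_of_nonneg_right (by exact_mod_cast hG.card_le v) hd0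

/-! ### The random experiment -/

/-- The standing assumptions for one round of random colouring. -/
structure NibbleSetup (G : J → SimpleGraph V) (S : J → Finset V) (W : Finset V)
    (L : V → Finset K) (C n : ℕ) (d p : ℝ) : Prop where
  nearlyDisjoint : NearlyDisjoint G S C
  C_pos : 0 < C
  n_pos : 0 < n
  d_pos : 0 < d
  d_le : d ≤ n
  p_pos : 0 < p
  p_le : C * p ≤ 1 / 2
  card_list : ∀ v ∈ W, (L v).card = n
  card_nbrs : ∀ v ∈ W, ∀ c ∈ L v, ∀ i, ((colourNbrs (G i) W L v c).card : ℝ) ≤ d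

/-- The common probability that a colour survives in a list. -/
noncomputable def keep (C n : ℕ) (d p : ℝ) : ℝ := 1 - C * (p * (d / n))

/-- Each vertex `v` picks each colour `c` independently with probability `p / n` (coordinate
`(v, c, false)`), and an equalizing coin (coordinate `(v, c, true)`) removes `c` from the list of
`v`, so that all colours survive with the same probability. -/
noncomputable def law (G : J → SimpleGraph V) (W : Finset V) (L : V → Finset K) (C n : ℕ)
    (d p : ℝ) : V × K × Bool → ℝ
  | (_, _, false) => p / n
  | (v, c, true) => if v ∈ W ∧ c ∈ L v then
      1 - keep C n d p / (1 - p / n) ^ (colourNbrs (⨆ i, G i) W L v c).card else 0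

/-- The coordinates that have to vanish for `c` to survive in the list of `v`. -/
noncomputable def listTest (G : J → SimpleGraph V) (W : Finset V) (L : V → Finset K) (c : K)
    (v : V) : Finset (V × K × Bool) :=
  insert (v, c, true) ((colourNbrs (⨆ i, G i) W L v c).image fun u => (u, c, false))

/-- If these coordinates vanish, then `u` picks no colour, and `c` is not removed from the list of
`u` because of an edge outside `G i`. -/
noncomputable def degTest (G : J → SimpleGraph V) (W : Finset V) (L : V → Finset K) (i : J) (c : K)
    (u : V) : Finset (V × K × Bool) :=
  insert (u, c, true) ((L u).image (fun γ => (u, γ, false)) ∪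
    (colourNbrs (⨆ i, G i) W L u c \ colourNbrs (G i) W L u c).image fun w => (w, c, false))

omit [Fintype J] in
theorem degTest_disjoint (G : J → SimpleGraph V) (W : Finset V) (L : V → Finset K) (i : J)
    (c : K) (u : V) :
    Disjoint ((L u).image (fun γ => (u, γ, false)))
      ((colourNbrs (⨆ i, G i) W L u c \ colourNbrs (G i) W L u c).image
        fun w => (w, c, false)) := by
  rw [disjoint_left]
  intro t ht ht'
  simp only [mem_image, mem_sdiff, mem_colourNbrs] at ht ht'
  obtain ⟨γ, _, rfl⟩ := ht
  obtain ⟨w, hw, he⟩ := ht'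
  obtain rfl : w = u := (Prod.ext_iff.1 he).1
  exact hw.1.2.1.ne rfl

omit [Fintype J] in
theorem card_filter_mem_listTest_le (G : J → SimpleGraph V) (W : Finset V) (L : V → Finset K) (v : V)
    (t : V × K × Bool) :
    ((L v).filter fun c => t ∈ listTest G W L c v).card ≤ 1 := by
  refine card_le_one.2 fun c hc c' hc' => ?_
  simp only [mem_filter, listTest, mem_insert, mem_image] at hc hc'
  have key : ∀ x : K, (t = (v, x, true) ∨ ∃ u ∈ colourNbrs (⨆ i, G i) W L v x,
      (u, x, false) = t) → t.2.1 = x := by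
    rintro x (rfl | ⟨u, _, rfl⟩) <;> rfl
  rw [← key c hc.2, ← key c' hc'.2]

namespace NibbleSetup

variable {G : J → SimpleGraph V} {S : J → Finset V} {W : Finset V} {L : V → Finset K}
  {C n : ℕ} {d p : ℝ} (h : NibbleSetup G S W L C n d p)

include h

theorem n_pos' : (0 : ℝ) < n := by exact_mod_cast h.n_pos

theorem one_le_C : (1 : ℝ) ≤ C := by exact_mod_cast h.C_pos

theorem p_le_half : p ≤ 1 / 2 := by
  have := h.p_le
  have := mul_le_mul_of_nonneg_right h.one_le_C h.p_pos.le
  linarith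

theorem ratio_le : d / n ≤ 1 := (div_le_one h.n_pos').2 h.d_le

theorem ratio_pos : 0 < d / n := div_pos h.d_pos h.n_pos'

theorem activation_nonneg : 0 ≤ p / n := (div_pos h.p_pos h.n_pos').le

theorem activation_le : p / n ≤ 1 / 2 := by
  rw [div_le_iff₀ h.n_pos']
  have : (1 : ℝ) ≤ n := by exact_mod_cast h.n_pos
  linarith [h.p_le_half]

theorem mul_ratio_le : C * (p * (d / n)) ≤ 1 / 2 := by
  have := mul_le_mul_of_nonneg_left h.ratio_le (mul_nonneg (Nat.cast_nonneg C) h.p_pos.le)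
  have := h.p_le
  nlinarith

theorem half_le_keep : 1 / 2 ≤ keep C n d p := by
  have := h.mul_ratio_le
  rw [keep]; linarith

theorem card_allNbrs_le {v : V} {c : K} (hv : v ∈ W) (hc : c ∈ L v) :
    ((colourNbrs (⨆ i, G i) W L v c).card : ℝ) ≤ C * d :=
  card_colourNbrs_iSup_le h.nearlyDisjoint h.d_pos.le (h.card_nbrs v hv c hc)

theorem activation_mul_le {x : ℝ} (hx : x ≤ C * d) : p / n * x ≤ C * (p * (d / n)) := by
  refine (mul_le_mul_of_nonneg_left hx h.activation_nonneg).trans_eq ?_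
  field_simp

theorem keep_le_pow {v : V} {c : K} (hv : v ∈ W) (hc : c ∈ L v) :
    keep C n d p ≤ (1 - p / n) ^ (colourNbrs (⨆ i, G i) W L v c).card := by
  have h1 := one_add_mul_le_pow (a := -(p / n)) (by linarith [h.activation_le])
    (colourNbrs (⨆ i, G i) W L v c).card
  have h2 := h.activation_mul_le (h.card_allNbrs_le hv hc)
  rw [← sub_eq_add_neg] at h1
  refine le_trans ?_ h1
  rw [keep]; linarith

theorem law_nonneg (t : V × K × Bool) : 0 ≤ law G W L C n d p t := by
  rcases t with ⟨v, c, _ | _⟩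
  · exact h.activation_nonneg
  · simp only [law]
    split_ifs with hvc
    · have h1 := h.keep_le_pow hvc.1 hvc.2
      have h2 := h.half_le_keep
      rw [sub_nonneg, div_le_one (by linarith)]
      exact h1
    · exact le_rfl

theorem law_le_one (t : V × K × Bool) : law G W L C n d p t ≤ 1 := by
  rcases t with ⟨v, c, _ | _⟩
  · exact h.activation_le.trans (by norm_num)
  · simp only [law]
    split_ifs with hvc
    · have h1 := h.keep_le_pow hvc.1 hvc.2
      have h2 := h.half_le_keep
      have : 0 ≤ keep C n d p / (1 - p / n) ^ (colourNbrs (⨆ i, G i) W L v c).card :=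
        div_nonneg (by linarith) (by linarith)
      linarith
    · exact zero_le_one

theorem prod_listTest {v : V} {c : K} (hv : v ∈ W) (hc : c ∈ L v) :
    ∏ t ∈ listTest G W L c v, (1 - law G W L C n d p t) = keep C n d p := by
  rw [listTest, prod_insert (by simp), prod_image (by intro x _ y _ hxy; simpa using hxy)]
  have h1 := h.keep_le_pow hv hc
  have h2 := h.half_le_keep
  simp only [law, hv, hc, and_self, if_true, prod_const]
  have : (1 - p / n) ^ (colourNbrs (⨆ i, G i) W L v c).card ≠ 0 := by linarith
  field_simp
  ring

theorem sum_listTest_le {v : V} {c : K} (hv : v ∈ W) (hc : c ∈ L v) :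
    ∑ t ∈ listTest G W L c v, law G W L C n d p t ≤ 3 := by
  rw [listTest, sum_insert (by simp), sum_image (by intro x _ y _ hxy; simpa using hxy)]
  have h1 := h.law_le_one (v, c, true)
  have h2 := h.activation_mul_le (h.card_allNbrs_le hv hc)
  have h3 := h.mul_ratio_le
  have : ∑ x ∈ colourNbrs (⨆ i, G i) W L v c, law G W L C n d p (x, c, false) =
    p / n * (colourNbrs (⨆ i, G i) W L v c).card := by
    simp only [law, sum_const, nsmul_eq_mul]; ring
  linarith

theorem prod_degTest_le {u : V} {c : K} (i : J) (hu : u ∈ W) (hc : c ∈ L u) :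
    ∏ t ∈ degTest G W L i c u, (1 - law G W L C n d p t) ≤
      keep C n d p * Real.exp (-(p * (1 - d / n))) := by
  rw [degTest, prod_insert (by simp), prod_union (degTest_disjoint G W L i c u),
    prod_image (by intro x _ y _ hxy; simpa using hxy),
    prod_image (by intro x _ y _ hxy; simpa using hxy)]
  have h2 := h.half_le_keep
  have hsub : colourNbrs (G i) W L u c ⊆ colourNbrs (⨆ i, G i) W L u c := by
    intro w hw
    rw [mem_colourNbrs] at hw ⊢
    exact ⟨hw.1, SimpleGraph.iSup_adj.2 ⟨i, hw.2.1⟩, hw.2.2⟩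
  simp only [law, hu, hc, and_self, if_true, prod_const, h.card_list u hu]
  have hcard := card_sdiff_add_card_eq_card hsub
  set N := (colourNbrs (⨆ i, G i) W L u c).card
  set R := (colourNbrs (⨆ i, G i) W L u c \ colourNbrs (G i) W L u c).card
  have hM := h.card_nbrs u hu c hc i
  set M := (colourNbrs (G i) W L u c).card
  have hMn : M ≤ n := by exact_mod_cast hM.trans h.d_le
  obtain ⟨k, hk⟩ := Nat.exists_eq_add_of_le hMn
  have hx : (1 - p / n : ℝ) ≠ 0 := by linarith [h.activation_le]
  have hkr : (k : ℝ) = n - M := by rw [hk]; push_cast; ring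
  calc (1 - (1 - keep C n d p / (1 - p / n) ^ N)) * ((1 - p / n) ^ n * (1 - p / n) ^ R)
      = keep C n d p * (1 - p / n) ^ k := by
        have e1 : (1 - p / n : ℝ) ^ n = (1 - p / n) ^ M * (1 - p / n) ^ k := by
          rw [← pow_add, ← hk]
        rw [e1, ← hcard, pow_add]
        field_simp
        ring
    _ ≤ keep C n d p * Real.exp (-(p / n)) ^ k := by
        gcongr
        · linarith [h.activation_le]
        · exact Real.one_sub_le_exp_neg _
    _ ≤ _ := by
        rw [← Real.exp_nat_mul, hkr]
        gcongr ?_ * Real.exp ?_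
        · have e : p * (1 - d / n) = (n - d) * (p / n) := by
            have := h.n_pos'
            field_simp
          rw [e, mul_neg, neg_le_neg_iff]
          exact mul_le_mul_of_nonneg_right (by linarith) h.activation_nonneg

theorem sum_degTest_le {u : V} {c : K} (i : J) (hu : u ∈ W) (hc : c ∈ L u) :
    ∑ t ∈ degTest G W L i c u, law G W L C n d p t ≤ 3 := by
  rw [degTest, sum_insert (by simp), sum_union (degTest_disjoint G W L i c u),
    sum_image (by intro x _ y _ hxy; simpa using hxy),
    sum_image (by intro x _ y _ hxy; simpa using hxy)]
  have h1 := h.law_le_one (u, c, true)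
  have h3 := h.mul_ratio_le
  have h4 : ∑ x ∈ L u, law G W L C n d p (u, x, false) ≤ 1 / 2 := by
    simp only [law, sum_const, nsmul_eq_mul, h.card_list u hu]
    rw [mul_div_cancel₀ _ h.n_pos'.ne']
    exact h.p_le_half
  have h5 : ((colourNbrs (⨆ i, G i) W L u c \ colourNbrs (G i) W L u c).card : ℝ) ≤ C * d :=
    le_trans (by exact_mod_cast card_le_card sdiff_subset) (h.card_allNbrs_le hu hc)
  have h6 := h.activation_mul_le h5
  have : ∑ x ∈ colourNbrs (⨆ i, G i) W L u c \ colourNbrs (G i) W L u c,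
      law G W L C n d p (x, c, false) =
      p / n * (colourNbrs (⨆ i, G i) W L u c \ colourNbrs (G i) W L u c).card := by
    simp only [law, sum_const, nsmul_eq_mul]; ring
  linarith

theorem card_filter_mem_degTest_le (i : J) (v : V) (c : K) (t : V × K × Bool) :
    ((colourNbrs (G i) W L v c).filter fun u => t ∈ degTest G W L i c u).card ≤ C := by
  have hG := h.nearlyDisjoint
  obtain ⟨x, γ, b⟩ := t
  have key : ∀ u, (x, γ, b) ∈ degTest G W L i c u → u = x ∨ ∃ j, j ≠ i ∧ (G j).Adj u x := by
    intro u hu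
    simp only [degTest, mem_insert, mem_union, mem_image, mem_sdiff, mem_colourNbrs,
      SimpleGraph.iSup_adj, Prod.mk.injEq] at hu
    rcases hu with ⟨rfl, _⟩ | ⟨_, _, rfl, _⟩ | ⟨w, hw, rfl, _⟩
    · exact Or.inl rfl
    · exact Or.inl rfl
    · obtain ⟨⟨hwW, ⟨j, hj⟩, hc⟩, hn⟩ := hw
      refine Or.inr ⟨j, ?_, hj⟩
      rintro rfl
      exact hn ⟨hwW, hj, hc⟩
  have hmem : ∀ u ∈ (colourNbrs (G i) W L v c).filter fun u => (x, γ, b) ∈ degTest G W L i c u,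
      u ∈ S i ∧ (u = x ∨ ∃ j, j ≠ i ∧ (G j).Adj u x) := fun u hu => by
    rw [mem_filter, mem_colourNbrs] at hu
    exact ⟨hG.mem_right hu.1.2.1, key u hu.2⟩
  by_cases hx : x ∈ S i
  · refine (card_le_one.2 fun u hu u' hu' => ?_).trans h.C_pos
    have aux : ∀ u, u ∈ S i ∧ (u = x ∨ ∃ j, j ≠ i ∧ (G j).Adj u x) → u = x := by
      rintro u ⟨hui, rfl | ⟨j, hj, hadj⟩⟩
      · rfl
      · exact hG.eq_of_mem hj (hG.mem_left hadj) hui (hG.mem_right hadj) hx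
    rw [aux u (hmem u hu), aux u' (hmem u' hu')]
  · have aux : ∀ u ∈ (colourNbrs (G i) W L v c).filter
        (fun u => (x, γ, b) ∈ degTest G W L i c u), ∃ j, j ≠ i ∧ (G j).Adj u x := by
      intro u hu
      obtain ⟨hui, rfl | hj⟩ := hmem u hu
      · exact absurd hui hx
      · exact hj
    have : Nonempty J := ⟨i⟩
    choose! f hf using aux
    refine le_trans (card_le_card_of_injOn f (t := univ.filter fun j => x ∈ S j) ?_ ?_)
      (hG.card_le x)
    · intro u hu
      simpa using hG.mem_right (hf u hu).2
    · intro u hu u' hu' he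
      refine hG.eq_of_mem (hf u hu).1 (hG.mem_left (hf u hu).2) (hmem u hu).1 ?_ (hmem u' hu').1
      rw [he]
      exact hG.mem_left (hf u' hu').2

end NibbleSetup

end Setup

section Round

variable {V J K : Type*} [Fintype V] [DecidableEq V] [Fintype J]
  [Fintype K] [DecidableEq K]

open Classical in
/-- The closed neighbourhood of `v`. -/
noncomputable def closedNbhd (H : SimpleGraph V) (v : V) : Finset V :=
  univ.filter fun u => u = v ∨ H.Adj v u

theorem mem_closedNbhd {H : SimpleGraph V} {u v : V} :
    u ∈ closedNbhd H v ↔ u = v ∨ H.Adj v u := by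
  classical
  simp [closedNbhd]

theorem mem_closedNbhd_comm {H : SimpleGraph V} {u v : V} :
    u ∈ closedNbhd H v ↔ v ∈ closedNbhd H u := by
  rw [mem_closedNbhd, mem_closedNbhd, eq_comm, H.adj_comm]

/-- The closed ball of radius two around `v`. -/
noncomputable def ballTwo (H : SimpleGraph V) (v : V) : Finset V :=
  (closedNbhd H v).biUnion (closedNbhd H)

theorem mem_ballTwo_comm {H : SimpleGraph V} {u v : V} : u ∈ ballTwo H v ↔ v ∈ ballTwo H u := by
  simp only [ballTwo, mem_biUnion]
  constructor <;>
  · rintro ⟨w, h1, h2⟩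
    exact ⟨w, mem_closedNbhd_comm.1 h2, mem_closedNbhd_comm.1 h1⟩

theorem closedNbhd_subset_ballTwo (H : SimpleGraph V) (v : V) :
    closedNbhd H v ⊆ ballTwo H v := fun u hu =>
  mem_biUnion.2 ⟨u, hu, mem_closedNbhd.2 (Or.inl rfl)⟩

theorem card_ballTwo_le {H : SimpleGraph V} {B : ℕ} (hB : ∀ v, (closedNbhd H v).card ≤ B) (v : V) :
    (ballTwo H v).card ≤ B ^ 2 := by
  refine (card_biUnion_le_card_mul _ _ B fun u _ => hB u).trans ?_
  rw [sq]
  exact Nat.mul_le_mul_right _ (hB v)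

theorem card_filter_not_disjoint_ballTwo_le {H : SimpleGraph V} {B : ℕ}
    (hB : ∀ v, (closedNbhd H v).card ≤ B) (W : Finset V) (v : V) :
    (W.filter fun u => ¬ Disjoint (ballTwo H v) (ballTwo H u)).card ≤ B ^ 4 := by
  have hsub : (W.filter fun u => ¬ Disjoint (ballTwo H v) (ballTwo H u)) ⊆
      (ballTwo H v).biUnion (ballTwo H) := by
    intro u hu
    obtain ⟨w, hw, hw'⟩ := not_disjoint_iff.1 (mem_filter.1 hu).2
    exact mem_biUnion.2 ⟨w, hw, mem_ballTwo_comm.1 hw'⟩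
  refine (card_le_card hsub).trans
    ((card_biUnion_le_card_mul _ _ (B ^ 2) fun u _ => card_ballTwo_le hB u).trans ?_)
  calc _ ≤ B ^ 2 * B ^ 2 := Nat.mul_le_mul_right _ (card_ballTwo_le hB v)
    _ = B ^ 4 := by ring

/-- The colours surviving in the list of `v`. -/
noncomputable def newList (G : J → SimpleGraph V) (W : Finset V) (L : V → Finset K)
    (ω : V × K × Bool → Bool) (v : V) : Finset K :=
  (L v).filter fun c => ∀ t ∈ listTest G W L c v, ω t = false

/-- The neighbours of `v` for the colour `c` in `G i` that pick no colour and do not lose `c`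
because of an edge outside `G i`. -/
noncomputable def survivors (G : J → SimpleGraph V) (W : Finset V) (L : V → Finset K) (i : J)
    (v : V) (c : K) (ω : V × K × Bool → Bool) : Finset V :=
  (colourNbrs (G i) W L v c).filter fun u => ∀ t ∈ degTest G W L i c u, ω t = false

/-- The neighbours of `v` for the colour `c` in `G i` that pick a colour also picked by one of
their neighbours. -/
noncomputable def conflicts (G : J → SimpleGraph V) (W : Finset V) (L : V → Finset K) (i : J)
    (v : V) (c : K) (ω : V × K × Bool → Bool) : Finset V :=
  (colourNbrs (G i) W L v c).filter fun u => ∃ γ ∈ L u, ω (u, γ, false) = true ∧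
    ∃ w ∈ colourNbrs (⨆ i, G i) W L u γ, ω (w, γ, false) = true

/-- The event that the list of `v` or some colour degree at `v` deviates. -/
def bad (G : J → SimpleGraph V) (S : J → Finset V) (W : Finset V) (L : V → Finset K) (C n : ℕ)
    (d p : ℝ) (v : V) : Set (V × K × Bool → Bool) :=
  {ω | ((newList G W L ω v).card : ℝ) ≤ (keep C n d p - p ^ 2) * n} ∪
    ⋃ x ∈ L v ×ˢ univ.filter fun i => v ∈ S i,
      ({ω | (keep C n d p * Real.exp (-(p * (1 - d / n))) + p ^ 2) * d ≤
          (survivors G W L x.2 v x.1 ω).card} ∪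
        {ω | 22 * C * p ^ 2 * d ≤ ((conflicts G W L x.2 v x.1 ω).card : ℝ)})

omit [Fintype J] [Fintype K] in
theorem fst_mem_closedNbhd_of_mem_listTest {G : J → SimpleGraph V} {W : Finset V}
    {L : V → Finset K} {c : K} {v : V} {t : V × K × Bool} (ht : t ∈ listTest G W L c v) :
    t.1 ∈ closedNbhd (⨆ i, G i) v := by
  simp only [listTest, mem_insert, mem_image] at ht
  rw [mem_closedNbhd]
  rcases ht with rfl | ⟨u, hu, rfl⟩
  · exact Or.inl rfl
  · exact Or.inr (mem_colourNbrs.1 hu).2.1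

omit [Fintype J] [Fintype K] in
theorem fst_mem_closedNbhd_of_mem_degTest {G : J → SimpleGraph V} {W : Finset V}
    {L : V → Finset K} {i : J} {c : K} {v : V} {t : V × K × Bool}
    (ht : t ∈ degTest G W L i c v) : t.1 ∈ closedNbhd (⨆ i, G i) v := by
  simp only [degTest, mem_insert, mem_union, mem_image, mem_sdiff] at ht
  rw [mem_closedNbhd]
  rcases ht with rfl | ⟨γ, _, rfl⟩ | ⟨u, hu, rfl⟩
  · exact Or.inl rfl
  · exact Or.inl rfl
  · exact Or.inr (mem_colourNbrs.1 hu.1).2.1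

omit [Fintype J] [Fintype K] in
theorem closedNbhd_subset_ballTwo_of_mem_colourNbrs {G : J → SimpleGraph V} {W : Finset V}
    {L : V → Finset K} {i : J} {c : K} {u v : V} (hu : u ∈ colourNbrs (G i) W L v c) :
    closedNbhd (⨆ i, G i) u ⊆ ballTwo (⨆ i, G i) v :=
  subset_biUnion_of_mem _ (mem_closedNbhd.2
    (Or.inr (SimpleGraph.iSup_adj.2 ⟨i, (mem_colourNbrs.1 hu).2.1⟩)))

theorem dependsOn_bad (G : J → SimpleGraph V) (S : J → Finset V) (W : Finset V)
    (L : V → Finset K) (C n : ℕ) (d p : ℝ) (v : V) :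
    DependsOn (· ∈ bad G S W L C n d p v)
      ((ballTwo (⨆ i, G i) v ×ˢ (univ : Finset (K × Bool)) : Finset (V × K × Bool)) :
        Set (V × K × Bool)) := by
  intro ω ω' hω
  have hω' : ∀ t : V × K × Bool, t.1 ∈ ballTwo (⨆ i, G i) v → ω t = ω' t :=
    fun t ht => hω t (by simpa using ht)
  have h1 : newList G W L ω v = newList G W L ω' v :=
    filter_congr fun c _ => forall₂_congr fun t ht => by
      rw [hω' t (closedNbhd_subset_ballTwo _ _ (fst_mem_closedNbhd_of_mem_listTest ht))]
  have h2 : ∀ i c, survivors G W L i v c ω = survivors G W L i v c ω' := fun i c =>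
    filter_congr fun u hu => forall₂_congr fun t ht => by
      rw [hω' t (closedNbhd_subset_ballTwo_of_mem_colourNbrs hu
        (fst_mem_closedNbhd_of_mem_degTest ht))]
  have h3 : ∀ i c, conflicts G W L i v c ω = conflicts G W L i v c ω' := fun i c =>
    filter_congr fun u hu => by
      have hsub := closedNbhd_subset_ballTwo_of_mem_colourNbrs hu
      have e1 : ∀ γ, ω (u, γ, false) = ω' (u, γ, false) := fun γ =>
        hω' _ (hsub (mem_closedNbhd.2 (Or.inl rfl)))
      have e2 : ∀ γ, ∀ w ∈ colourNbrs (⨆ i, G i) W L u γ, ω (w, γ, false) = ω' (w, γ, false) :=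
        fun γ w hw => hω' _ (hsub (mem_closedNbhd.2 (Or.inr (mem_colourNbrs.1 hw).2.1)))
      simp only [e1]
      constructor <;>
      · rintro ⟨γ, hγ, hu', w, hw, hw'⟩
        have := e2 γ w hw
        exact ⟨γ, hγ, hu', w, hw, by simp_all⟩
  simp only [bad, Set.mem_union, Set.mem_iUnion, Set.mem_ofPred_eq, h1, h2, h3]

namespace NibbleSetup

variable {G : J → SimpleGraph V} {S : J → Finset V} {W : Finset V} {L : V → Finset K}
  {C n : ℕ} {d p : ℝ} (h : NibbleSetup G S W L C n d p)

include h

theorem prob_newList_le {v : V} (hv : v ∈ W) :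
    prob (bernoulli (law G W L C n d p))
      {ω | ((newList G W L ω v).card : ℝ) ≤ (keep C n d p - p ^ 2) * n} ≤
        Real.exp (-(p ^ 4 * d / (12 * C))) := by
  have hp := h.p_le_half
  have hp0 := h.p_pos
  have hmain := prob_count_le_le h.law_nonneg h.law_le_one (L v) (fun c => listTest G W L c v)
    (card_filter_mem_listTest_le G W L v) (fun c hc => h.sum_listTest_le hv hc) (l := p ^ 2 / 6)
    (by positivity) (by norm_num; nlinarith) (η := p ^ 2)
    (fun c hc => (h.prod_listTest hv hc).ge)
  rw [h.card_list v hv] at hmain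
  refine hmain.trans (Real.exp_le_exp.2 ?_)
  have hC := h.one_le_C
  have hd : p ^ 4 * d / (12 * C) ≤ p ^ 4 * n / 12 := by
    rw [div_le_div_iff₀ (by linarith) (by norm_num)]
    have h1 : p ^ 4 * d ≤ p ^ 4 * n := mul_le_mul_of_nonneg_left h.d_le (by positivity)
    have h2 : 0 ≤ p ^ 4 * n := mul_nonneg (by positivity) h.n_pos'.le
    nlinarith
  push_cast
  nlinarith

theorem prob_survivors_le (v : V) (i : J) {c : K} (hv : v ∈ W) (hc : c ∈ L v) :
    prob (bernoulli (law G W L C n d p))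
      {ω | (keep C n d p * Real.exp (-(p * (1 - d / n))) + p ^ 2) * d ≤
        (survivors G W L i v c ω).card} ≤ Real.exp (-(p ^ 4 * d / (12 * C))) := by
  have hp := h.p_le_half
  have hp0 := h.p_pos
  have hC := h.one_le_C
  have hk := h.half_le_keep
  have hmain := prob_count_ge_le h.law_nonneg h.law_le_one (colourNbrs (G i) W L v c)
    (fun u => degTest G W L i c u) (h.card_filter_mem_degTest_le i v c) (M := 3) (by norm_num)
    (fun u hu => h.sum_degTest_le i (mem_colourNbrs.1 hu).1 (mem_colourNbrs.1 hu).2.2)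
    (l := p ^ 2 / (6 * C)) (by positivity)
    (by
      rw [div_mul_eq_mul_div, div_le_one (by linarith)]
      nlinarith [mul_nonneg (Nat.cast_nonneg C : (0 : ℝ) ≤ C)
        (by nlinarith : (0 : ℝ) ≤ 1 - p ^ 2)])
    (x := keep C n d p * Real.exp (-(p * (1 - d / n)))) (η := p ^ 2) (m := d)
    (mul_nonneg (by linarith) (Real.exp_pos _).le)
    (fun u hu => h.prod_degTest_le i (mem_colourNbrs.1 hu).1 (mem_colourNbrs.1 hu).2.2)
    (h.card_nbrs v hv c hc i)
  refine hmain.trans (Real.exp_le_exp.2 (le_of_eq ?_))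
  field_simp
  ring

theorem prob_conflicts_le (v : V) (i : J) {c : K} (hv : v ∈ W) (hc : c ∈ L v) :
    prob (bernoulli (law G W L C n d p))
      {ω | 22 * C * p ^ 2 * d ≤ ((conflicts G W L i v c ω).card : ℝ)} ≤
        Real.exp (-(p ^ 4 * d / (12 * C))) := by
  have hp := h.p_le_half
  have hp0 := h.p_pos
  have hC := h.one_le_C
  have hd := h.d_pos
  have hn := h.n_pos'
  have hr := h.ratio_le
  have hr0 := h.ratio_pos
  have hmoment := expect_exp_conflicts_le h.law_nonneg h.law_le_one (a := p / n)
    (fun _ _ => rfl) (colourNbrs (G i) W L v c) (h.card_nbrs v hv c hc i)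
    (by rw [mul_assoc, div_mul_eq_mul_div, mul_div_assoc]; nlinarith)
    (fun u γ => colourNbrs (⨆ i, G i) W L u γ)
    (fun u γ hu => (mem_colourNbrs.1 hu).2.1.ne rfl) (m := C * d) (by positivity) L
    (fun u hu => (h.card_list u (mem_colourNbrs.1 hu).1).le)
    (fun u hu γ hγ => h.card_allNbrs_le (mem_colourNbrs.1 hu).1 hγ)
  refine (prob_ge_le_exp (isWeight_bernoulli h.law_nonneg h.law_le_one) _ _).trans ?_
  refine (mul_le_mul_of_nonneg_left hmoment (Real.exp_pos _).le).trans ?_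
  rw [← Real.exp_add]
  refine Real.exp_le_exp.2 ?_
  have e1 : d * n * (C * d * (21 * (p / n) ^ 2)) = 21 * C * p ^ 2 * d * (d / n) := by
    field_simp
  have h1 : 21 * C * p ^ 2 * d * (d / n) ≤ 21 * C * p ^ 2 * d :=
    mul_le_of_le_one_right (by positivity) hr
  have h2 : p ^ 4 * d / (12 * C) ≤ C * p ^ 2 * d := by
    rw [div_le_iff₀ (by linarith)]
    have : p ^ 4 ≤ p ^ 2 := pow_le_pow_of_le_one hp0.le (by linarith) (by norm_num)
    have h3 : p ^ 4 * d ≤ p ^ 2 * d := mul_le_mul_of_nonneg_right this hd.le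
    have h4 : (1 : ℝ) ≤ C * (12 * C) := by nlinarith
    have h5 : 0 ≤ p ^ 2 * d := by positivity
    nlinarith
  rw [e1]
  linarith

theorem prob_bad_le {v : V} (hv : v ∈ W) :
    prob (bernoulli (law G W L C n d p)) (bad G S W L C n d p v) ≤
      3 * C * n * Real.exp (-(p ^ 4 * d / (12 * C))) := by
  have hμ := isWeight_bernoulli h.law_nonneg h.law_le_one
  set E := Real.exp (-(p ^ 4 * d / (12 * C)))
  have hE : 0 < E := Real.exp_pos _
  refine (prob_union_le hμ _ _).trans ?_
  have h1 := h.prob_newList_le hv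
  have h2 : prob (bernoulli (law G W L C n d p))
      (⋃ x ∈ L v ×ˢ univ.filter fun i => v ∈ S i,
      ({ω | (keep C n d p * Real.exp (-(p * (1 - d / n))) + p ^ 2) * d ≤
          (survivors G W L x.2 v x.1 ω).card} ∪
        {ω | 22 * C * p ^ 2 * d ≤ ((conflicts G W L x.2 v x.1 ω).card : ℝ)})) ≤
      n * C * (2 * E) := by
    refine (prob_biUnion_le hμ _ _).trans ?_
    refine (sum_le_card_nsmul _ _ (2 * E) fun x hx => ?_).trans ?_
    · have hc := (mem_product.1 hx).1
      refine (prob_union_le hμ _ _).trans ?_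
      linarith [h.prob_survivors_le v x.2 hv hc, h.prob_conflicts_le v x.2 hv hc]
    · rw [nsmul_eq_mul, card_product, h.card_list v hv]
      push_cast
      gcongr
      exact h.nearlyDisjoint.card_le v
  have h3 : (1 : ℝ) ≤ C * n := one_le_mul_of_one_le_of_one_le h.one_le_C
    (by exact_mod_cast h.n_pos)
  nlinarith

/-- With positive probability nothing deviates. -/
theorem exists_forall_notMem_bad {B : ℕ} (hB0 : 0 < B)
    (hB : ∀ v, (closedNbhd (⨆ i, G i) v).card ≤ B)
    (hsmall : 3 * C * n * Real.exp (-(p ^ 4 * d / (12 * C))) ≤ 1 / (4 * (B : ℝ) ^ 4)) :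
    ∃ ω, ∀ v ∈ W, ω ∉ bad G S W L C n d p v := by
  refine exists_avoiding (isWeight_bernoulli h.law_nonneg h.law_le_one) W _
    (fun v => ballTwo (⨆ i, G i) v ×ˢ univ) (fun v _ => dependsOn_bad G S W L C n d p v) (B ^ 4)
    (by positivity) (fun v _ => ?_) fun v hv => (h.prob_bad_le hv).trans (by exact_mod_cast hsmall)
  refine (card_le_card ?_).trans (card_filter_not_disjoint_ballTwo_le hB W v)
  intro u hu
  rw [mem_filter] at hu ⊢
  refine ⟨hu.1, fun hdisj => hu.2 ?_⟩
  exact disjoint_product.2 (Or.inl hdisj)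

omit [Fintype J] h in
theorem colourNbrs_subset {W' : Finset V} (hW' : W' ⊆ W) {ω : V × K × Bool → Bool}
    (hunc : ∀ v ∈ W', ∀ γ ∈ L v, ω (v, γ, false) = true →
      ∃ u ∈ colourNbrs (⨆ i, G i) W L v γ, ω (u, γ, false) = true) (i : J) (v : V) (c : K) :
    colourNbrs (G i) W' (newList G W L ω) v c ⊆
      survivors G W L i v c ω ∪ conflicts G W L i v c ω := by
  intro u hu
  rw [mem_colourNbrs, newList, mem_filter] at hu
  obtain ⟨huW, hadj, hcu, hsurv⟩ := hu
  have hU : u ∈ colourNbrs (G i) W L v c := mem_colourNbrs.2 ⟨hW' huW, hadj, hcu⟩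
  by_cases hall : ∀ t ∈ degTest G W L i c u, ω t = false
  · exact mem_union_left _ (mem_filter.2 ⟨hU, hall⟩)
  · push Not at hall
    obtain ⟨t, ht, hωt⟩ := hall
    refine mem_union_right _ (mem_filter.2 ⟨hU, ?_⟩)
    simp only [degTest, mem_insert, mem_union, mem_image, mem_sdiff] at ht
    rcases ht with rfl | ⟨γ, hγ, rfl⟩ | ⟨w, hw, rfl⟩
    · exact absurd (hsurv _ (mem_insert_self _ _)) hωt
    · have : ω (u, γ, false) = true := by simpa using hωt
      exact ⟨γ, hγ, this, hunc u huW γ hγ this⟩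
    · exact absurd (hsurv _ (mem_insert_of_mem (mem_image_of_mem _ hw.1))) hωt

/-- One round of random colouring: to colour `W` from `L` it is enough to colour all smaller
instances with the expected list sizes and colour degrees. -/
theorem isColourable {B : ℕ} (hB0 : 0 < B)
    (hB : ∀ v, (closedNbhd (⨆ i, G i) v).card ≤ B)
    (hsmall : 3 * C * n * Real.exp (-(p ^ 4 * d / (12 * C))) ≤ 1 / (4 * (B : ℝ) ^ 4))
    (hnext : ∀ (W' : Finset V) (L' : V → Finset K),
      (∀ v ∈ W', (keep C n d p - p ^ 2) * n ≤ (L' v).card) →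
      (∀ v ∈ W', ∀ c ∈ L' v, ∀ i, ((colourNbrs (G i) W' L' v c).card : ℝ) ≤
        (keep C n d p * Real.exp (-(p * (1 - d / n))) + 23 * C * p ^ 2) * d) →
      IsColourable (⨆ i, G i) W' L') :
    IsColourable (⨆ i, G i) W L := by
  classical
  obtain ⟨ω, hω⟩ := h.exists_forall_notMem_bad hB0 hB hsmall
  let coloured : V → Prop := fun v => ∃ γ ∈ L v, ω (v, γ, false) = true ∧
    ∀ u ∈ colourNbrs (⨆ i, G i) W L v γ, ω (u, γ, false) = false
  let W' := W.filter fun v => ¬ coloured v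
  have hW' : W' ⊆ W := filter_subset _ _
  have hunc : ∀ v ∈ W', ∀ γ ∈ L v, ω (v, γ, false) = true →
      ∃ u ∈ colourNbrs (⨆ i, G i) W L v γ, ω (u, γ, false) = true := by
    intro v hv γ hγ hpick
    by_contra! hcon
    exact (mem_filter.1 hv).2 ⟨γ, hγ, hpick, fun u hu => by simpa using hcon u hu⟩
  have hlist : ∀ v ∈ W', (keep C n d p - p ^ 2) * n ≤ (newList G W L ω v).card := by
    intro v hv
    have := hω v (hW' hv)
    simp only [bad, Set.mem_union, Set.mem_ofPred_eq, not_or, not_le] at this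
    exact this.1.le
  have hdeg : ∀ v ∈ W', ∀ c ∈ newList G W L ω v, ∀ i,
      ((colourNbrs (G i) W' (newList G W L ω) v c).card : ℝ) ≤
        (keep C n d p * Real.exp (-(p * (1 - d / n))) + 23 * C * p ^ 2) * d := by
    intro v hv c hc i
    have hk := h.half_le_keep
    have hd := h.d_pos
    by_cases hvS : v ∈ S i
    · have hbad := hω v (hW' hv)
      simp only [bad, Set.mem_union, Set.mem_iUnion, Set.mem_ofPred_eq, not_or, not_le,
        not_exists] at hbad
      have hcL : c ∈ L v := (mem_filter.1 hc).1
      obtain ⟨h1, h2⟩ := hbad.2 (c, i) (by simp [hcL, hvS])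
      have h3 : ((colourNbrs (G i) W' (newList G W L ω) v c).card : ℝ) ≤
          (survivors G W L i v c ω).card + (conflicts G W L i v c ω).card := by
        exact_mod_cast (card_le_card (colourNbrs_subset hW' hunc i v c)).trans
          (card_union_le _ _)
      have h4 : p ^ 2 * d ≤ C * (p ^ 2 * d) :=
        le_mul_of_one_le_left (by positivity) h.one_le_C
      dsimp only at h1 h2
      linarith
    · have hempty : colourNbrs (G i) W' (newList G W L ω) v c = ∅ := by
        refine eq_empty_of_forall_notMem fun u hu => hvS ?_
        exact h.nearlyDisjoint.mem_left (mem_colourNbrs.1 hu).2.1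
      rw [hempty, card_empty, Nat.cast_zero]
      have := Real.exp_pos (-(p * (1 - d / n)))
      positivity
  obtain ⟨φ, hφL, hφ⟩ := hnext W' (newList G W L ω) hlist hdeg
  have hφ' : ∀ v ∈ W', φ v ∈ L v ∧ ∀ t ∈ listTest G W L (φ v) v, ω t = false :=
    fun v hv => mem_filter.1 (hφL v hv)
  have hex : ∀ v, ∃ γ, coloured v → γ ∈ L v ∧ ω (v, γ, false) = true ∧
      ∀ u ∈ colourNbrs (⨆ i, G i) W L v γ, ω (u, γ, false) = false := fun v => by
    by_cases hv : coloured v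
    · obtain ⟨γ, hγ⟩ := hv
      exact ⟨γ, fun _ => hγ⟩
    · exact ⟨φ v, fun hv' => absurd hv' hv⟩
  choose ψ hψ' using hex
  have hψL := fun v hv => (hψ' v hv).1
  have hψpick := fun v hv => (hψ' v hv).2.1
  have hψ := fun v hv => (hψ' v hv).2.2
  have hmixed : ∀ u ∈ W, ∀ v ∈ W', coloured u → (⨆ i, G i).Adj v u → ψ u ≠ φ v := by
    intro u hu v hv hcol hadj he
    have hmem : u ∈ colourNbrs (⨆ i, G i) W L v (φ v) :=
      mem_colourNbrs.2 ⟨hu, hadj, he ▸ hψL u hcol⟩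
    have h1 := (hφ' v hv).2 _ (mem_insert_of_mem (mem_image_of_mem _ hmem))
    have h2 := hψpick u hcol
    rw [he] at h2
    simp [h1] at h2
  have hmemW' : ∀ v ∈ W, ¬ coloured v → v ∈ W' := fun v hv hcol => mem_filter.2 ⟨hv, hcol⟩
  refine ⟨fun v => if coloured v then ψ v else φ v, fun v hv => ?_, fun u hu v hv hadj => ?_⟩
  · dsimp only
    split_ifs with hcol
    · exact hψL v hcol
    · exact (hφ' v (hmemW' v hv hcol)).1
  · dsimp only
    split_ifs with hcu hcv hcv
    · intro he
      have h1 := hψ u hcu v (mem_colourNbrs.2 ⟨hv, hadj, he ▸ hψL v hcv⟩)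
      have h2 := hψpick v hcv
      rw [← he] at h2
      simp [h1] at h2
    · exact hmixed u hu v (hmemW' v hv hcv) hcu hadj.symm
    · exact (hmixed v hv u (hmemW' u hu hcu) hcv hadj).symm
    · exact hφ u (hmemW' u hu hcu) v (hmemW' v hv hcv) hadj

end NibbleSetup

end Round

/-! ### Finishing the colouring when the colour degrees are small -/

section Finish

variable {V K : Type*} [Fintype V] [DecidableEq V] [DecidableEq K]

omit [Fintype V] [DecidableEq V] in
theorem colourNbrs_mono {H : SimpleGraph V} {W : Finset V} {L L' : V → Finset K}
    (hL : ∀ v ∈ W, L' v ⊆ L v) (v : V) (c : K) : colourNbrs H W L' v c ⊆ colourNbrs H W L v c := by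
  intro u hu
  rw [mem_colourNbrs] at hu ⊢
  exact ⟨hu.1, hu.2.1, hL u hu.1 hu.2.2⟩

omit [Fintype V] [DecidableEq V] [DecidableEq K] in
theorem IsColourable.mono {H : SimpleGraph V} {W : Finset V} {L L' : V → Finset K}
    (hL : ∀ v ∈ W, L' v ⊆ L v) (h : IsColourable H W L') : IsColourable H W L := by
  obtain ⟨φ, h1, h2⟩ := h
  exact ⟨φ, fun v hv => hL v hv (h1 v hv), h2⟩

theorem prob_eq_and_eq {n : ℕ} (hn : 0 < n) {u w : V} (huw : u ≠ w) (i j : Fin n) :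
    prob (fun (_ : V) (_ : Fin n) => (1 : ℝ) / n) {ω | ω u = i ∧ ω w = j} = 1 / n * (1 / n) := by
  classical
  have hμ : IsWeight (fun (_ : V) (_ : Fin n) => (1 : ℝ) / n) :=
    ⟨fun _ _ => by positivity, fun _ => by simp [hn.ne']⟩
  have h := expect_prod_coordinates hμ {u, w}
    (fun x a => if a = (if x = u then i else j) then 1 else 0)
  rw [prod_pair huw] at h
  simp only [prod_pair huw, if_true, huw.symm, if_false, mul_ite, mul_one, mul_zero,
    sum_ite_eq', mem_univ] at h
  rw [← h, prob]
  congr 1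
  ext ω
  by_cases h1 : ω u = i <;> by_cases h2 : ω w = j <;> simp [h1, h2]

/-- If every colour degree is at most `n / 16`, then lists of size `n` suffice. -/
theorem isColourable_of_card_colourNbrs_le [Nonempty K] {H : SimpleGraph V} {W : Finset V}
    {L : V → Finset K} {n : ℕ} (hn : 2 ≤ n) (hL : ∀ v ∈ W, (L v).card = n)
    (hdeg : ∀ v ∈ W, ∀ c ∈ L v, ((colourNbrs H W L v c).card : ℝ) ≤ n / 16) :
    IsColourable H W L := by
  classical
  have hf : ∀ v, ∃ f : Fin n → K, v ∈ W → Function.Injective f ∧ ∀ i, f i ∈ L v := fun v => by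
    by_cases hv : v ∈ W
    · refine ⟨fun i => (L v).equivFin.symm (Fin.cast (hL v hv).symm i), fun _ => ⟨?_, fun i => ?_⟩⟩
      · intro i j hij
        simpa [Subtype.ext_iff] using hij
      · exact ((L v).equivFin.symm _).2
    · exact ⟨fun _ => Classical.arbitrary K, fun h => absurd h hv⟩
  choose f hf using hf
  let T : Finset (V × V × Fin n × Fin n) := univ.filter fun b =>
    b.1 ∈ W ∧ b.2.1 ∈ W ∧ H.Adj b.1 b.2.1 ∧ f b.1 b.2.2.1 = f b.2.1 b.2.2.2
  have hT : ∀ b, b ∈ T ↔ b.1 ∈ W ∧ b.2.1 ∈ W ∧ H.Adj b.1 b.2.1 ∧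
      f b.1 b.2.2.1 = f b.2.1 b.2.2.2 := fun b => by simp [T]
  have hfst : ∀ x, ((T.filter fun b => b.1 = x).card : ℝ) ≤ n * (n / 16) := by
    intro x
    by_cases hx : x ∈ W
    · have hinj : (T.filter fun b => b.1 = x).card ≤
          (univ.sigma fun i => colourNbrs H W L x (f x i)).card := by
        refine card_le_card_of_injOn (fun b => ⟨b.2.2.1, b.2.1⟩) ?_ ?_
        · rintro ⟨u, w, i, j⟩ hb
          obtain ⟨hbT, rfl⟩ := mem_filter.1 hb
          obtain ⟨hu, hw, hadj, he⟩ := (hT _).1 hbT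
          simp only [coe_sigma, Set.mem_sigma_iff, mem_coe, mem_univ, true_and]
          exact mem_colourNbrs.2 ⟨hw, hadj, by rw [he]; exact (hf w hw).2 j⟩
        · rintro ⟨u, w, i, j⟩ hb ⟨u', w', i', j'⟩ hb' he
          obtain ⟨hbT, rfl⟩ := mem_filter.1 hb
          obtain ⟨hbT', rfl⟩ := mem_filter.1 hb'
          obtain ⟨hu, hw, hadj, he1⟩ := (hT _).1 hbT
          obtain ⟨hu', hw', hadj', he2⟩ := (hT _).1 hbT'
          simp only [Sigma.mk.injEq, heq_eq_eq] at he
          obtain ⟨rfl, rfl⟩ := he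
          have := (hf w hw).1 (he1.symm.trans he2)
          simp_all
      refine le_trans (Nat.cast_le.2 hinj) ?_
      rw [card_sigma]
      push_cast
      refine (sum_le_card_nsmul _ _ _ fun i _ => hdeg x hx _ ((hf x hx).2 i)).trans ?_
      simp
    · have : T.filter (fun b => b.1 = x) = ∅ := by
        refine eq_empty_of_forall_notMem fun b hb => hx ?_
        obtain ⟨hbT, rfl⟩ := mem_filter.1 hb
        exact ((hT _).1 hbT).1
      rw [this]
      simp only [card_empty, Nat.cast_zero]
      positivity
  have hsnd : ∀ x, ((T.filter fun b => b.2.1 = x).card : ℝ) ≤ n * (n / 16) := by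
    intro x
    refine le_trans ?_ (hfst x)
    have : (T.filter fun b => b.2.1 = x).card ≤ (T.filter fun b => b.1 = x).card := by
      refine card_le_card_of_injOn (fun b => (b.2.1, b.1, b.2.2.2, b.2.2.1)) ?_ ?_
      · rintro ⟨u, w, i, j⟩ hb
        obtain ⟨hbT, rfl⟩ := mem_filter.1 hb
        obtain ⟨hu, hw, hadj, he⟩ := (hT _).1 hbT
        exact mem_filter.2 ⟨(hT _).2 ⟨hw, hu, hadj.symm, he.symm⟩, rfl⟩
      · rintro ⟨u, w, i, j⟩ _ ⟨u', w', i', j'⟩ _ he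
        simp_all
    exact_mod_cast this
  have hn0 : (0 : ℝ) < n := by exact_mod_cast (by omega : 0 < n)
  have hn2 : 0 < n ^ 2 / 4 := Nat.div_pos (by nlinarith) (by norm_num)
  have hdep : ∀ b ∈ T, (T.filter fun b' =>
      ¬ Disjoint ({b.1, b.2.1} : Finset V) {b'.1, b'.2.1}).card ≤ n ^ 2 / 4 := by
    intro b _
    rw [Nat.le_div_iff_mul_le (by norm_num)]
    have hsub : (T.filter fun b' => ¬ Disjoint ({b.1, b.2.1} : Finset V) {b'.1, b'.2.1}) ⊆
        ((T.filter fun b' => b'.1 = b.1) ∪ (T.filter fun b' => b'.1 = b.2.1)) ∪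
        ((T.filter fun b' => b'.2.1 = b.1) ∪ (T.filter fun b' => b'.2.1 = b.2.1)) := by
      intro b' hb'
      rw [mem_filter, not_disjoint_iff] at hb'
      obtain ⟨hb', x, hx, hx'⟩ := hb'
      simp only [mem_insert, mem_singleton] at hx hx'
      simp only [mem_union, mem_filter, hb', true_and]
      rcases hx with rfl | rfl <;> rcases hx' with h | h <;> simp [h]
    have h1 := (card_le_card hsub).trans ((card_union_le _ _).trans
      (add_le_add (card_union_le _ _) (card_union_le _ _)))
    have h2 : ((T.filter fun b' => ¬ Disjoint ({b.1, b.2.1} : Finset V) {b'.1, b'.2.1}).card : ℝ) ≤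
        ((T.filter fun b' => b'.1 = b.1).card + (T.filter fun b' => b'.1 = b.2.1).card) +
        ((T.filter fun b' => b'.2.1 = b.1).card + (T.filter fun b' => b'.2.1 = b.2.1).card) := by
      exact_mod_cast h1
    have h3 : ((T.filter fun b' => ¬ Disjoint ({b.1, b.2.1} : Finset V) {b'.1, b'.2.1}).card : ℝ) *
        4 ≤ n ^ 2 := by
      nlinarith [hfst b.1, hfst b.2.1, hsnd b.1, hsnd b.2.1]
    exact_mod_cast h3
  have hprob : ∀ b ∈ T, prob (fun (_ : V) (_ : Fin n) => (1 : ℝ) / n)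
      {ω | ω b.1 = b.2.2.1 ∧ ω b.2.1 = b.2.2.2} ≤ 1 / (4 * (n ^ 2 / 4 : ℕ)) := by
    intro b hb
    rw [prob_eq_and_eq (by omega) ((hT b).1 hb).2.2.1.ne]
    have h4 : (4 : ℝ) * (n ^ 2 / 4 : ℕ) ≤ n ^ 2 := by
      exact_mod_cast Nat.mul_div_le (n ^ 2) 4
    have h5 : (0 : ℝ) < (n ^ 2 / 4 : ℕ) := by exact_mod_cast hn2
    rw [one_div_mul_one_div, ← sq]
    exact one_div_le_one_div_of_le (by positivity) h4
  obtain ⟨ω, hω⟩ := exists_avoiding (μ := fun (_ : V) (_ : Fin n) => (1 : ℝ) / n)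
    ⟨fun _ _ => by positivity, fun _ => by simp [hn0.ne']⟩ T
    (fun b => {ω | ω b.1 = b.2.2.1 ∧ ω b.2.1 = b.2.2.2}) (fun b => {b.1, b.2.1})
    (fun b _ ω ω' hω => by
      simp only [Set.mem_ofPred_eq, hω b.1 (by simp), hω b.2.1 (by simp)])
    (n ^ 2 / 4) hn2 hdep hprob
  refine ⟨fun v => f v (ω v), fun v hv => (hf v hv).2 _, fun u hu v hv hadj he => ?_⟩
  exact hω (u, v, ω u, ω v) ((hT _).2 ⟨hu, hv, hadj, he⟩) ⟨rfl, rfl⟩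

end Finish

/-! ### Iterating the random colouring -/

/-- The gain in the ratio of colour degrees to list sizes. -/
theorem keep_mul_exp_le {C n : ℕ} {d p ε : ℝ} (hC : 0 < C) (hn : 0 < n) (hd : 0 ≤ d)
    (hε : 0 < ε) (hε1 : ε ≤ 1) (hp : p = ε / (100 * C)) (hdn : d / n ≤ 1 - ε) :
    keep C n d p * Real.exp (-(p * (1 - d / n))) + 23 * C * p ^ 2 ≤
      (1 - p * ε / 2) * (keep C n d p - p ^ 2) := by
  have hC1 : (1 : ℝ) ≤ C := by exact_mod_cast hC
  have hCp : C * p = ε / 100 := by rw [hp]; field_simp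
  have hp0 : 0 < p := by rw [hp]; positivity
  have hp1 : p ≤ 1 / 100 := by nlinarith
  have hr : 0 ≤ d / n := by positivity
  have hpr : C * (p * (d / n)) ≤ 1 / 100 := by
    rw [← mul_assoc, hCp]; nlinarith
  have hpr0 : 0 ≤ C * (p * (d / n)) := by positivity
  have hexp : Real.exp (-(p * (1 - d / n))) ≤ 1 - p * ε + p ^ 2 := by
    have h1 : Real.exp (-(p * (1 - d / n))) ≤ Real.exp (-(p * ε)) :=
      Real.exp_le_exp.2 (by nlinarith)
    have h2 : |-(p * ε)| ≤ 1 := by rw [abs_neg, abs_of_pos (by positivity)]; nlinarith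
    have h3 := (abs_le.1 (Real.abs_exp_sub_one_sub_id_le h2)).2
    have h4 : (-(p * ε)) ^ 2 ≤ p ^ 2 := by
      rw [neg_sq, mul_pow]
      exact mul_le_of_le_one_right (by positivity) (pow_le_one₀ hε.le hε1)
    linarith
  have hk : keep C n d p = 1 - C * (p * (d / n)) := rfl
  have hk1 : 1 / 2 ≤ keep C n d p := by linarith
  have hk2 : keep C n d p ≤ 1 := by linarith
  have h1 := mul_le_mul_of_nonneg_left hexp (by linarith : 0 ≤ keep C n d p)
  have hCp2 : C * p ^ 2 = ε / 100 * p := by rw [sq, ← mul_assoc, hCp]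
  have hp2 : p ^ 2 ≤ ε / 100 * p := by
    rw [← hCp2]; exact le_mul_of_one_le_left (by positivity) hC1
  have h2 : keep C n d p * p ^ 2 ≤ p ^ 2 := mul_le_of_le_one_left (by positivity) hk2
  have h3 : 1 / 2 * (p * ε) ≤ keep C n d p * (p * ε) :=
    mul_le_mul_of_nonneg_right hk1 (by positivity)
  have h4 : 0 ≤ p * ε / 2 * p ^ 2 := by positivity
  nlinarith

theorem exists_forall_ge_mul_exp_le (C : ℕ) {β : ℝ} (hβ : 0 < β) (A : ℕ) :
    ∃ N : ℕ, ∀ n : ℕ, N ≤ n → 0 < n →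
      3 * C * n * Real.exp (-(β * n)) ≤ 1 / (4 * (((A + 1) * n : ℕ) : ℝ) ^ 4) := by
  have h1 : Filter.Tendsto (fun n : ℕ => (β * n) ^ 5 * Real.exp (-(β * n))) Filter.atTop
      (nhds 0) :=
    (Real.tendsto_pow_mul_exp_neg_atTop_nhds_zero 5).comp
      (tendsto_natCast_atTop_atTop.const_mul_atTop hβ)
  have h2 := h1.const_mul (12 * C * ((A : ℝ) + 1) ^ 4 / β ^ 5)
  rw [mul_zero] at h2
  obtain ⟨N, hN⟩ := Filter.eventually_atTop.1 (h2.eventually (gt_mem_nhds zero_lt_one))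
  refine ⟨N, fun n hn hn0 => ?_⟩
  have h3 := hN n hn
  have hn0' : (0 : ℝ) < n := by exact_mod_cast hn0
  rw [le_div_iff₀ (by positivity)]
  push_cast
  refine le_trans (le_of_eq ?_) h3.le
  field_simp
  ring

theorem exists_subset_card_eq_of_mem {V K : Type*} {W : Finset V} {L : V → Finset K} {n : ℕ}
    (hL : ∀ v ∈ W, n ≤ (L v).card) (v : V) : ∃ T ⊆ L v, v ∈ W → T.card = n := by
  by_cases hv : v ∈ W
  · obtain ⟨T, hT, hTn⟩ := exists_subset_card_eq (hL v hv)
    exact ⟨T, hT, fun _ => hTn⟩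
  · exact ⟨L v, Subset.rfl, fun h => absurd h hv⟩

theorem isColourable_of_forall_card_nbrs_le (C : ℕ) (hC : 0 < C) (ε : ℝ) (hε : 0 < ε)
    (hε1 : ε ≤ 1) (r : ℕ) :
    ∀ A : ℕ, ∃ N : ℕ, ∀ n : ℕ, N ≤ n → ∀ ρ : ℝ, 0 < ρ → ρ ≤ 1 - ε →
      ρ * (1 - ε / (100 * C) * ε / 2) ^ r ≤ 1 / (16 * C) →
      ∀ (V J K : Type) [Fintype V] [DecidableEq V] [Fintype J] [Fintype K] [DecidableEq K]
        [Nonempty K] (G : J → SimpleGraph V) (S : J → Finset V) (W : Finset V) (L : V → Finset K),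
        NearlyDisjoint G S C →
        (∀ v, (closedNbhd (⨆ i, G i) v).card ≤ A * n) →
        (∀ v ∈ W, n ≤ (L v).card) →
        (∀ v ∈ W, ∀ c ∈ L v, ∀ i, ((colourNbrs (G i) W L v c).card : ℝ) ≤ ρ * n) →
        IsColourable (⨆ i, G i) W L := by
  have hC1 : (1 : ℝ) ≤ C := by exact_mod_cast hC
  set p := ε / (100 * C) with hp
  have hp0 : 0 < p := by positivity
  have hCp : C * p = ε / 100 := by rw [hp]; field_simp
  have hp1 : p ≤ 1 / 100 := by nlinarith
  have hθ0 : 0 < 1 - p * ε / 2 := by nlinarith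
  have hθ1 : 1 - p * ε / 2 ≤ 1 := by nlinarith
  have small : ∀ n : ℕ, 2 ≤ n → ∀ ρ : ℝ, 0 < ρ → ρ ≤ 1 / (16 * C) →
      ∀ (V J K : Type) [Fintype V] [DecidableEq V] [Fintype J] [Fintype K] [DecidableEq K]
        [Nonempty K] (G : J → SimpleGraph V) (S : J → Finset V) (W : Finset V) (L : V → Finset K),
        NearlyDisjoint G S C → (∀ v ∈ W, (L v).card = n) →
        (∀ v ∈ W, ∀ c ∈ L v, ∀ i, ((colourNbrs (G i) W L v c).card : ℝ) ≤ ρ * n) →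
        IsColourable (⨆ i, G i) W L := by
    intro n hn ρ hρ0 hρ V J K _ _ _ _ _ _ G S W L hG hL hdeg
    refine isColourable_of_card_colourNbrs_le hn hL fun v hv c hc => ?_
    refine (card_colourNbrs_iSup_le hG (by positivity) (hdeg v hv c hc)).trans ?_
    rw [le_div_iff₀ (by positivity)] at hρ
    have : 0 ≤ (n : ℝ) := n.cast_nonneg
    nlinarith
  induction r with
  | zero =>
    intro A
    refine ⟨2, fun n hn ρ hρ0 _ hρ V J K _ _ _ _ _ _ G S W L hG _ hL hdeg => ?_⟩
    choose L' hL' hL'n using exists_subset_card_eq_of_mem hL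
    refine IsColourable.mono (fun v _ => hL' v) ?_
    refine small n hn ρ hρ0 (by simpa using hρ) V J K G S W L' hG hL'n fun v hv c hc i => ?_
    exact le_trans (Nat.cast_le.2 (card_le_card (colourNbrs_mono (fun v _ => hL' v) v c)))
      (hdeg v hv c (hL' v hc) i)
  | succ r ih =>
    intro A
    obtain ⟨N₁, hN₁⟩ := ih (4 * A)
    obtain ⟨N₂, hN₂⟩ := exists_forall_ge_mul_exp_le C
      (β := p ^ 4 * (1 / (16 * C)) / (12 * C)) (by positivity) A
    refine ⟨4 * N₁ + N₂ + 2, fun n hn ρ hρ0 hρ1 hρ V J K _ _ _ _ _ _ G S W L hG hA hL hdeg => ?_⟩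
    choose L' hL' hL'n using exists_subset_card_eq_of_mem hL
    refine IsColourable.mono (fun v _ => hL' v) ?_
    have hdeg' : ∀ v ∈ W, ∀ c ∈ L' v, ∀ i,
        ((colourNbrs (G i) W L' v c).card : ℝ) ≤ ρ * n := fun v hv c hc i =>
      le_trans (Nat.cast_le.2 (card_le_card (colourNbrs_mono (fun v _ => hL' v) v c)))
        (hdeg v hv c (hL' v hc) i)
    by_cases hρs : ρ ≤ 1 / (16 * C)
    · exact small n (by omega) ρ hρ0 hρs V J K G S W L' hG hL'n hdeg'
    have hn0 : 0 < n := by omega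
    have hn0' : (0 : ℝ) < n := by exact_mod_cast hn0
    have hratio : ρ * n / n = ρ := mul_div_cancel_right₀ _ hn0'.ne'
    have hset : NibbleSetup G S W L' C n (ρ * n) p :=
      { nearlyDisjoint := hG
        C_pos := hC
        n_pos := hn0
        d_pos := by positivity
        d_le := by nlinarith
        p_pos := hp0
        p_le := by rw [hCp]; linarith
        card_list := hL'n
        card_nbrs := hdeg' }
    have hgain := keep_mul_exp_le (d := ρ * n) hC hn0 (by positivity) hε hε1 hp
      (by rw [hratio]; exact hρ1)
    have hkeep := hset.half_le_keep
    have hkp : 1 / 4 ≤ keep C n (ρ * n) p - p ^ 2 := by nlinarith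
    refine hset.isColourable (B := (A + 1) * n) (by positivity)
      (fun v => (hA v).trans (Nat.mul_le_mul_right _ (by omega))) ?_ fun W' L'' hW' hdeg'' => ?_
    · refine le_trans ?_ (hN₂ n (by omega) hn0)
      refine mul_le_mul_of_nonneg_left (Real.exp_le_exp.2 (neg_le_neg ?_)) (by positivity)
      rw [div_mul_eq_mul_div]
      gcongr ?_ / _
      rw [mul_assoc]
      gcongr
      exact (not_le.1 hρs).le
    · set n' := ⌈(keep C n (ρ * n) p - p ^ 2) * n⌉₊ with hn'
      have hle : (keep C n (ρ * n) p - p ^ 2) * n ≤ n' := Nat.le_ceil _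
      have hquarter : n ≤ 4 * n' := by
        have : (n : ℝ) ≤ 4 * n' := by nlinarith
        exact_mod_cast this
      refine hN₁ n' (by omega) (ρ * (1 - p * ε / 2)) (by positivity) ?_ ?_ V J K G S W' L'' hG
        (fun v => (hA v).trans ?_) (fun v hv => Nat.ceil_le.2 (hW' v hv)) fun v hv c hc i => ?_
      · exact (mul_le_of_le_one_right hρ0.le hθ1).trans hρ1
      · rw [mul_assoc, ← pow_succ']; exact hρ
      · calc A * n ≤ A * (4 * n') := Nat.mul_le_mul_left _ hquarter
          _ = 4 * A * n' := by ring
      · calc ((colourNbrs (G i) W' L'' v c).card : ℝ) ≤ _ := hdeg'' v hv c hc i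
          _ ≤ (1 - p * ε / 2) * (keep C n (ρ * n) p - p ^ 2) * (ρ * n) :=
            mul_le_mul_of_nonneg_right hgain (by positivity)
          _ = ρ * (1 - p * ε / 2) * ((keep C n (ρ * n) p - p ^ 2) * n) := by ring
          _ ≤ _ := mul_le_mul_of_nonneg_left hle (by positivity)

end ListNibble

open ListNibble

/-- **A special case of Vu's conjecture.**
For every `C, ε > 0` there exists `D₀` such that for all `D ≥ D₀`: if `G₁, …, G_m` are
nearly disjoint graphs (with vertex sets `S i`), each of maximum degree at most `D`, such
that each vertex of `⋃ᵢ V(Gᵢ)` is contained in at most `C` of them, then the list chromatic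
number of `⋃ᵢ Gᵢ` is at most `(1 + ε)D`. -/
theorem vu_special_case (C ε : ℝ) (hC : 0 < C) (hε : 0 < ε) :
    ∃ D₀ : ℕ, ∀ D : ℕ, D₀ ≤ D →
      ∀ (V : Type) [Fintype V] [DecidableEq V] (m : ℕ) (G : Fin m → SimpleGraph V)
        [∀ i, DecidableRel (G i).Adj] (S : Fin m → Finset V),
        (∀ i u v, (G i).Adj u v → u ∈ S i ∧ v ∈ S i) →
        (∀ i j, i ≠ j → (S i ∩ S j).card ≤ 1) →
        (∀ i v, (G i).degree v ≤ D) →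
        (∀ v ∈ (univ : Finset (Fin m)).biUnion S,
          ((univ.filter fun i => v ∈ S i).card : ℝ) ≤ C) →
        ∀ L : V → Finset ℕ,
          (∀ v ∈ (univ : Finset (Fin m)).biUnion S, (1 + ε) * D ≤ ((L v).card : ℝ)) →
          ∃ φ : V → ℕ, (∀ v ∈ (univ : Finset (Fin m)).biUnion S, φ v ∈ L v) ∧
            ∀ u v, (⨆ i, G i).Adj u v → φ u ≠ φ v := by
  set k := ⌈C⌉₊ with hk
  have hk0 : 0 < k := Nat.ceil_pos.2 hC
  have hk1 : (1 : ℝ) ≤ k := by exact_mod_cast hk0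
  set δ := ε / (1 + ε) with hδ
  have hδ0 : 0 < δ := by positivity
  have hδ1 : δ ≤ 1 := (div_le_one (by linarith)).2 (by linarith)
  have hδρ : 1 / (1 + ε) = 1 - δ := by rw [hδ]; field_simp; ring
  have hθ : 1 - δ / (100 * k) * δ / 2 < 1 := by
    have : 0 < δ / (100 * k) * δ / 2 := by positivity
    linarith
  have hθ0 : 0 ≤ 1 - δ / (100 * k) * δ / 2 := by
    have h1 : δ / (100 * k) ≤ 1 := by
      rw [div_le_one (by positivity)]; linarith
    have : 0 < δ / (100 * k) := by positivity
    nlinarith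
  obtain ⟨r, hr⟩ := exists_pow_lt_of_lt_one (by positivity : (0 : ℝ) < 1 / (16 * k)) hθ
  obtain ⟨N, hN⟩ := isColourable_of_forall_card_nbrs_le k hk0 δ hδ0 hδ1 r (k + 1)
  refine ⟨N + 1, fun D hD V _ _ m G _ S hGS hSS hdeg hSC L hL => ?_⟩
  have hD0 : (0 : ℝ) < D := by exact_mod_cast (by omega : 0 < D)
  set n := ⌈(1 + ε) * (D : ℝ)⌉₊ with hn
  have hnD : (1 + ε) * (D : ℝ) ≤ n := Nat.le_ceil _
  have hDn : D ≤ n := by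
    have : (D : ℝ) ≤ n := by nlinarith
    exact_mod_cast this
  have hG : NearlyDisjoint G S k :=
    { mem_left := fun h => (hGS _ _ _ h).1
      mem_right := fun h => (hGS _ _ _ h).2
      eq_of_mem := fun hij hui huj hvi hvj =>
        card_le_one.1 (hSS _ _ hij) _ (mem_inter.2 ⟨hui, huj⟩) _ (mem_inter.2 ⟨hvi, hvj⟩)
      card_le := fun v => by
        by_cases hv : v ∈ (univ : Finset (Fin m)).biUnion S
        · exact_mod_cast (hSC v hv).trans (Nat.le_ceil C)
        · rw [filter_eq_empty_iff.2 fun i _ hi => hv (mem_biUnion.2 ⟨i, mem_univ i, hi⟩)]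
          exact Nat.zero_le _ }
  have hnbhd : ∀ v, (closedNbhd (⨆ i, G i) v).card ≤ (k + 1) * n := by
    intro v
    have hsub : closedNbhd (⨆ i, G i) v ⊆
        insert v ((univ.filter fun i => v ∈ S i).biUnion fun i => (G i).neighborFinset v) := by
      intro u hu
      rw [mem_closedNbhd, SimpleGraph.iSup_adj] at hu
      rcases hu with rfl | ⟨i, hi⟩
      · exact mem_insert_self _ _
      · refine mem_insert_of_mem (mem_biUnion.2 ⟨i, ?_, by simpa using hi⟩)
        simpa using (hGS i _ _ hi).1
    have h1 := card_biUnion_le_card_mul (univ.filter fun i => v ∈ S i)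
      (fun i => (G i).neighborFinset v) D fun i _ => hdeg i v
    have h2 := Nat.mul_le_mul (hG.card_le v) hDn
    have h3 := (card_le_card hsub).trans (card_insert_le _ _)
    have h4 := Nat.mul_le_mul_right D (hG.card_le v)
    nlinarith
  set M := (univ.biUnion L).sup id with hM
  have hLM : ∀ v, ∀ c ∈ L v, c < M + 1 := fun v c hc =>
    Nat.lt_succ_of_le (le_sup (f := id) (mem_biUnion.2 ⟨v, mem_univ v, hc⟩))
  let L' : V → Finset (Fin (M + 1)) := fun v => univ.filter fun c => (c : ℕ) ∈ L v
  have hL' : ∀ v, (L' v).card = (L v).card := fun v =>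
    card_bij (fun c _ => (c : ℕ)) (fun c hc => by simpa [L'] using hc)
      (fun c _ c' _ h => Fin.ext h)
      fun c hc => ⟨⟨c, hLM v c hc⟩, by simpa [L'] using hc, rfl⟩
  obtain ⟨φ, hφL, hφ⟩ := hN n (by omega) (1 / (1 + ε)) (by positivity) hδρ.le
    ((mul_le_of_le_one_left (pow_nonneg hθ0 r)
      ((div_le_one (by linarith)).2 (by linarith))).trans hr.le)
    V (Fin m) (Fin (M + 1)) G S (univ.biUnion S) L' hG hnbhd
    (fun v hv => Nat.ceil_le.2 (by rw [hL']; exact hL v hv))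
    (fun v _ c _ i => by
      have h1 : (colourNbrs (G i) (univ.biUnion S) L' v c).card ≤ (G i).degree v :=
        card_le_card fun u hu => by simpa using (mem_colourNbrs.1 hu).2.1
      have h2 : (D : ℝ) ≤ 1 / (1 + ε) * n := by
        rw [div_mul_eq_mul_div, le_div_iff₀ (by linarith)]
        linarith
      exact le_trans (Nat.cast_le.2 (h1.trans (hdeg i v))) h2)
  refine ⟨fun v => φ v, fun v hv => by simpa [L'] using hφL v hv, fun u v hadj he => ?_⟩
  obtain ⟨i, hi⟩ := SimpleGraph.iSup_adj.1 hadj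
  exact hφ u (mem_biUnion.2 ⟨i, mem_univ i, (hGS i u v hi).1⟩) v
    (mem_biUnion.2 ⟨i, mem_univ i, (hGS i u v hi).2⟩) hadj (Fin.ext he)
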